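/- Let p > 3 be a prime with p ≡ 3 (mod 4), and let a, b be integers with Legendre symbol (−ab/p) = −1. Let C̄_p(a,b,x) denote the determinant of the ((p+1)/2)×((p+1)/2) real matrix whose row j = 0 has all entries equal to 1 and whose (j,k) entry for 1 ≤ j ≤ (p−1)/2, 0 ≤ k ≤ (p−1)/2 is x + cot(π(aj²+bk²)/p). Then for every real number x, C̄_p(a,b,x) = (−1)^{(h(−p)−1)/2}·(a/p)·2^{(p−1)/2}/√p. -/

import Mathlib

section PartP2
open Finset

section halfsystem
variable {p : ℕ} [Fact p.Prime]

lemma cast_ne_zero_of_mem_half {j : ℕ} (hj : j ∈ Icc 1 (p / 2)) : (j : ZMod p) ≠ 0 := by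
  have hp := (Fact.out : p.Prime).two_le
  rw [mem_Icc] at hj
  intro h
  rw [ZMod.natCast_eq_zero_iff] at h
  have := Nat.le_of_dvd (by omega) h
  omega

lemma half_sq_inj {j k : ℕ} (hj : j ≤ p / 2) (hk : k ≤ p / 2) (hodd : p % 2 = 1)
    (h : (j : ZMod p) ^ 2 = (k : ZMod p) ^ 2) : j = k := by
  have hp := (Fact.out : p.Prime).two_le
  rcases sq_eq_sq_iff_eq_or_eq_neg.mp h with h | h
  · rw [ZMod.natCast_eq_natCast_iff'] at h
    rwa [Nat.mod_eq_of_lt (by omega), Nat.mod_eq_of_lt (by omega)] at h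
  · have h2 : ((j + k : ℕ) : ZMod p) = 0 := by push_cast; rw [h]; ring
    rw [ZMod.natCast_eq_zero_iff] at h2
    by_cases h0 : j + k = 0
    · omega
    · have := Nat.le_of_dvd (by omega) h2
      omega

lemma exists_half_rep (u : ZMod p) : ∃ j : ℕ, j ≤ p / 2 ∧ (u = j ∨ u = -(j : ZMod p)) := by
  refine ⟨u.valMinAbs.natAbs, ZMod.natAbs_valMinAbs_le u, ?_⟩
  have h := ZMod.coe_valMinAbs u
  rcases Int.natAbs_eq u.valMinAbs with h1 | h1
  · left
    conv_lhs => rw [← h, h1]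
    simp
  · right
    conv_lhs => rw [← h, h1]
    simp

lemma neg_one_not_square (hp4 : p % 4 = 3) : ¬ IsSquare (-1 : ZMod p) := by
  intro h
  have := ZMod.exists_sq_eq_neg_one_iff.mp h
  omega

lemma master_prod {M : Type*} [CommMonoid M] (f : ZMod p → M) (g : ℕ → ZMod p)
    (hodd : p % 2 = 1)
    (h0 : ∀ j ∈ Icc 1 (p / 2), g j ≠ 0)
    (h1 : ∀ j ∈ Icc 1 (p / 2), ∀ k ∈ Icc 1 (p / 2), g j = g k → j = k)
    (h2 : ∀ j ∈ Icc 1 (p / 2), ∀ k ∈ Icc 1 (p / 2), g j ≠ - g k) :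
    ∏ j ∈ Icc 1 (p / 2), (f (g j) * f (- g j)) = ∏ u ∈ univ.erase (0 : ZMod p), f u := by
  rw [prod_mul_distrib]
  have e1 : ∏ j ∈ Icc 1 (p / 2), f (g j) = ∏ u ∈ (Icc 1 (p / 2)).image g, f u := by
    rw [prod_image]; intro a ha b hb; exact h1 a ha b hb
  have i2 : Set.InjOn (fun j => - g j) (Icc 1 (p / 2) : Finset ℕ) := by
    intro a ha b hb hab; exact h1 a ha b hb (by simpa using hab)
  have e2 : ∏ j ∈ Icc 1 (p / 2), f (- g j) = ∏ u ∈ (Icc 1 (p / 2)).image (fun j => - g j), f u := by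
    rw [prod_image i2]
  have hd : Disjoint ((Icc 1 (p / 2)).image g) ((Icc 1 (p / 2)).image (fun j => - g j)) := by
    rw [disjoint_left]
    intro x hx hy
    rw [mem_image] at hx hy
    obtain ⟨j, hj, rfl⟩ := hx
    obtain ⟨k, hk, hk2⟩ := hy
    exact h2 j hj k hk hk2.symm
  rw [e1, e2, ← prod_union hd]
  congr 1
  apply eq_of_subset_of_card_le
  · intro x hx
    rw [mem_union, mem_image, mem_image] at hx
    rw [mem_erase]
    refine ⟨?_, mem_univ _⟩
    rcases hx with ⟨j, hj, rfl⟩ | ⟨j, hj, rfl⟩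
    · exact h0 j hj
    · simpa using h0 j hj
  · rw [card_union_of_disjoint hd, card_image_of_injOn i2,
      card_image_of_injOn (fun a ha b hb => h1 a ha b hb), card_erase_of_mem (mem_univ _),
      card_univ, ZMod.card, Nat.card_Icc]
    omega

lemma sq_ne_neg_sq (hp4 : p % 4 = 3) {u v : ZMod p} (hv : v ≠ 0) : u ^ 2 ≠ - v ^ 2 := by
  intro h
  apply neg_one_not_square hp4
  refine ⟨u / v, ?_⟩
  field_simp
  rw [h]

lemma prod_sq_rep {M : Type*} [CommMonoid M] (hp4 : p % 4 = 3) (f : ZMod p → M) :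
    ∏ j ∈ Icc 1 (p / 2), (f ((j : ZMod p) ^ 2) * f (- (j : ZMod p) ^ 2)) =
      ∏ u ∈ univ.erase (0 : ZMod p), f u := by
  apply master_prod f (fun j => (j : ZMod p) ^ 2) (by omega)
  · intro j hj; exact pow_ne_zero _ (cast_ne_zero_of_mem_half hj)
  · intro j hj k hk h
    exact half_sq_inj (mem_Icc.mp hj).2 (mem_Icc.mp hk).2 (by omega) h
  · intro j hj k hk
    exact sq_ne_neg_sq hp4 (cast_ne_zero_of_mem_half hk)

lemma prod_half_rep {M : Type*} [CommMonoid M] (hodd : p % 2 = 1) (f : ZMod p → M) :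
    ∏ j ∈ Icc 1 (p / 2), (f (j : ZMod p) * f (- (j : ZMod p))) =
      ∏ u ∈ univ.erase (0 : ZMod p), f u := by
  apply master_prod f (fun j => (j : ZMod p)) hodd
  · intro j hj; exact (cast_ne_zero_of_mem_half hj)
  · intro j hj k hk h
    exact half_sq_inj (mem_Icc.mp hj).2 (mem_Icc.mp hk).2 (by omega) (by rw [h])
  · intro j hj k hk h
    have h3 : (j : ZMod p) ^ 2 = (k : ZMod p) ^ 2 := by rw [h]; ring
    have := half_sq_inj (mem_Icc.mp hj).2 (mem_Icc.mp hk).2 (by omega) h3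
    subst this
    have h4 : ((2 * j : ℕ) : ZMod p) = 0 := by push_cast; linear_combination h
    rw [ZMod.natCast_eq_zero_iff] at h4
    rw [mem_Icc] at hj
    have := Nat.le_of_dvd (by omega) h4
    omega

lemma prod_chi_rep {M : Type*} [CommMonoid M] (hp4 : p % 4 = 3) (f : ZMod p → M) :
    ∏ j ∈ Icc 1 (p / 2), f ((j : ZMod p) ^ 2) =
      ∏ k ∈ Icc 1 (p / 2), f (((quadraticChar (ZMod p) (k : ZMod p) : ℤ) : ZMod p) * k) := by
  set χ := quadraticChar (ZMod p)
  have i1 : Set.InjOn (fun j : ℕ => (j : ZMod p) ^ 2) (Icc 1 (p / 2) : Finset ℕ) := by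
    intro j hj k hk h
    exact half_sq_inj (mem_Icc.mp hj).2 (mem_Icc.mp hk).2 (by omega) h
  have hsq : ∀ k ∈ Icc 1 (p / 2), (((χ (k : ZMod p) : ℤ) : ZMod p)) ^ 2 = 1 := by
    intro k hk
    rw [← Int.cast_pow, quadraticChar_sq_one (cast_ne_zero_of_mem_half hk)]; simp
  have i2 : Set.InjOn (fun k : ℕ => ((χ (k : ZMod p) : ℤ) : ZMod p) * k) (Icc 1 (p / 2) : Finset ℕ) := by
    intro j hj k hk h
    refine half_sq_inj (mem_Icc.mp hj).2 (mem_Icc.mp hk).2 (by omega) ?_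
    have := congrArg (· ^ 2) h
    simp only [mul_pow] at this
    rwa [hsq j hj, hsq k hk, one_mul, one_mul] at this
  rw [← prod_image (g := fun j : ℕ => (j : ZMod p) ^ 2) (f := f) i1,
    ← prod_image (g := fun k : ℕ => ((χ (k : ZMod p) : ℤ) : ZMod p) * k) (f := f) i2]
  congr 1
  symm
  apply eq_of_subset_of_card_le
  · intro x hx
    rw [mem_image] at hx
    obtain ⟨k, hk, rfl⟩ := hx
    have hk0 := cast_ne_zero_of_mem_half hk
    have hs : IsSquare (((χ (k : ZMod p) : ℤ) : ZMod p) * k) := by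
      have hne : (((χ (k : ZMod p) : ℤ) : ZMod p) * k) ≠ 0 := by
        refine mul_ne_zero ?_ hk0
        intro h0
        have := hsq k hk
        rw [h0] at this
        simp at this
      rw [← quadraticChar_one_iff_isSquare hne]
      rcases quadraticChar_dichotomy hk0 with h | h
      · simp [χ, h]
      · have hm : quadraticChar (ZMod p) (-1) = -1 := by
          rw [quadraticChar_neg_one_iff_not_isSquare]
          exact neg_one_not_square hp4
        have : quadraticChar (ZMod p) (- (k : ZMod p)) = 1 := by
          rw [← neg_one_mul, map_mul, h, hm]; norm_num
        simpa [χ, h] using this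
    obtain ⟨y, hy⟩ := hs
    obtain ⟨j, hj, hj2⟩ := exists_half_rep y
    rw [mem_image]
    have h3 : (j : ZMod p) ^ 2 = ((χ (k : ZMod p) : ℤ) : ZMod p) * k := by
      rw [hy]; rcases hj2 with h | h <;> rw [h] <;> ring
    refine ⟨j, ?_, h3⟩
    rw [mem_Icc]
    refine ⟨?_, hj⟩
    by_contra hlt
    have : j = 0 := by omega
    subst this
    have := congrArg (· ^ 2) h3
    simp only [mul_pow] at this
    rw [hsq k hk] at this
    simp at this
    exact hk0 ((pow_eq_zero_iff two_ne_zero).mp this.symm)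
  · rw [card_image_of_injOn i1, card_image_of_injOn i2]
end halfsystem

end PartP2

section PartP1
open Finset

section gg
variable {p : ℕ} [Fact p.Prime]

/-- `|1 - ζ^u|`, with the value at `0` replaced by `1`. -/
noncomputable def gg (u : ZMod p) : ℝ := if u = 0 then 1 else ‖1 - ZMod.stdAddChar u‖

lemma gg_zero : gg (0 : ZMod p) = 1 := by simp [gg]

lemma gg_pos (u : ZMod p) : 0 < gg u := by
  unfold gg
  split_ifs with h
  · norm_num
  · rw [norm_pos_iff, sub_ne_zero]
    intro h1
    apply h
    apply ZMod.injective_stdAddChar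
    simp [← h1]

lemma norm_stdAddChar' (u : ZMod p) : ‖ZMod.stdAddChar u‖ = 1 := by
  rw [ZMod.stdAddChar_apply]; exact Circle.norm_coe _

lemma conj_stdAddChar (u : ZMod p) :
    (starRingEnd ℂ) (ZMod.stdAddChar u) = ZMod.stdAddChar (-u) := by
  rw [AddChar.map_neg_eq_inv, Complex.inv_def, Complex.normSq_eq_norm_sq, norm_stdAddChar']
  simp

lemma norm_sub_stdAddChar {u v : ZMod p} (h : u ≠ v) :
    ‖ZMod.stdAddChar u - ZMod.stdAddChar v‖ = gg (u - v) := by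
  unfold gg
  rw [if_neg (sub_ne_zero.mpr h)]
  have : ZMod.stdAddChar u - ZMod.stdAddChar v =
      - ZMod.stdAddChar v * (1 - ZMod.stdAddChar (u - v)) := by
    have : ZMod.stdAddChar u = ZMod.stdAddChar v * ZMod.stdAddChar (u - v) := by
      rw [← AddChar.map_add_eq_mul]; congr 1; ring
    rw [this]; ring
  rw [this, norm_mul, norm_neg, norm_stdAddChar', one_mul]

lemma gg_neg (u : ZMod p) : gg (-u) = gg u := by
  by_cases h : u = 0
  · simp [h]
  · have h1 := norm_sub_stdAddChar (u := u) (v := 0) h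
    have h2 := norm_sub_stdAddChar (u := 0) (v := u) (Ne.symm h)
    rw [sub_zero] at h1
    rw [zero_sub] at h2
    rw [← h1, ← h2, norm_sub_rev]

lemma prod_one_sub_stdAddChar :
    ∏ u ∈ univ.erase (0 : ZMod p), (1 - ZMod.stdAddChar u : ℂ) = p := by
  have hp := (Fact.out : p.Prime)
  have h1 : IsPrimitiveRoot (ZMod.stdAddChar (1 : ZMod p)) (p - 1 + 1) := by
    have : p - 1 + 1 = p := Nat.sub_add_cancel hp.one_le
    rw [this]
    have := Complex.isPrimitiveRoot_exp p hp.ne_zero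
    have h2 := ZMod.stdAddChar_coe (N := p) 1
    rw [Int.cast_one] at h2
    rw [h2]
    simpa using this
  have h2 := h1.prod_one_sub_pow_eq_order
  have h3 : ((p - 1 : ℕ) : ℂ) + 1 = p := by
    have : p - 1 + 1 = p := Nat.sub_add_cancel hp.one_le
    exact_mod_cast this
  rw [h3] at h2
  rw [← h2]
  symm
  apply prod_bij (fun k _ => ((k + 1 : ℕ) : ZMod p))
  · intro k hk
    rw [mem_range] at hk
    rw [mem_erase]
    refine ⟨?_, mem_univ _⟩
    rw [Ne, ZMod.natCast_eq_zero_iff]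
    intro h
    have := Nat.le_of_dvd (by omega) h
    omega
  · intro a ha b hb h
    rw [mem_range] at ha hb
    rw [ZMod.natCast_eq_natCast_iff'] at h
    rw [Nat.mod_eq_of_lt (by omega), Nat.mod_eq_of_lt (by omega)] at h
    omega
  · intro u hu
    rw [mem_erase] at hu
    have hv : u.val ≠ 0 := by rw [Ne, ZMod.val_eq_zero]; exact hu.1
    have hlt := ZMod.val_lt u
    refine ⟨u.val - 1, by rw [mem_range]; omega, ?_⟩
    have : u.val - 1 + 1 = u.val := by omega
    rw [this, ZMod.natCast_zmod_val]
  · intro k hk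
    rw [← AddChar.map_nsmul_eq_pow]
    simp

lemma prod_gg : ∏ u ∈ univ.erase (0 : ZMod p), gg u = p := by
  have h := congrArg norm (prod_one_sub_stdAddChar (p := p))
  rw [norm_prod] at h
  simp only [Complex.norm_natCast] at h
  rw [← h]
  apply prod_congr rfl
  intro u hu
  simp [gg, (mem_erase.mp hu).1]

lemma prod_gg_univ : ∏ u : ZMod p, gg u = p := by
  rw [← mul_prod_erase univ gg (mem_univ 0), gg_zero, prod_gg, one_mul]

lemma prod_gg_sq (hp4 : p % 4 = 3) {c : ZMod p} (hc : c ≠ 0) :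
    (∏ j ∈ Icc 1 (p / 2), gg (c * (j : ZMod p) ^ 2)) ^ 2 = p := by
  have h := prod_sq_rep hp4 (fun u => gg (c * u))
  have h1 : ∏ u ∈ univ.erase (0 : ZMod p), gg (c * u) = p := by
    rw [← prod_gg (p := p)]
    apply prod_bij (fun u _ => c * u)
    · intro u hu; simpa [hc] using hu
    · intro a _ b _ h; exact mul_left_cancel₀ hc h
    · intro b hb; refine ⟨c⁻¹ * b, ?_, ?_⟩
      · simpa [hc] using hb
      · field_simp
    · intros; rfl
  rw [h1] at h
  rw [← h, ← prod_pow]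
  apply prod_congr rfl
  intro j _
  rw [mul_neg, gg_neg, sq]

lemma prod_gg_diff (hp4 : p % 4 = 3) :
    (∏ j ∈ Icc 1 (p / 2), ∏ k ∈ Icc 1 (p / 2), gg ((j : ZMod p) ^ 2 - (k : ZMod p) ^ 2)) ^ 4
      * (p : ℝ) ^ 2 = (p : ℝ) ^ (p - 1) := by
  have hp := (Fact.out : p.Prime)
  have h2 : (2 : ZMod p) ≠ 0 := by
    intro h
    have : ((2 : ℕ) : ZMod p) = 0 := by exact_mod_cast h
    rw [ZMod.natCast_eq_zero_iff] at this
    have := Nat.le_of_dvd (by omega) this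
    have := hp.two_le
    omega
  -- hyperbola
  have hyp : ∏ x : ZMod p × ZMod p, gg (x.1 * x.2) = (p : ℝ) ^ (p - 1) := by
    rw [Fintype.prod_prod_type, ← mul_prod_erase univ _ (mem_univ 0)]
    have : ∀ u ∈ univ.erase (0 : ZMod p), ∏ v : ZMod p, gg (u * v) = p := by
      intro u hu
      rw [← prod_gg_univ (p := p)]
      exact Fintype.prod_equiv (Equiv.mulLeft₀ u (mem_erase.mp hu).1) _ _ (fun _ => rfl)
    rw [prod_congr rfl this]
    simp [gg_zero, card_erase_of_mem, ZMod.card]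
  let e : ZMod p × ZMod p ≃ ZMod p × ZMod p :=
    { toFun := fun x => (x.1 - x.2, x.1 + x.2)
      invFun := fun x => ((x.1 + x.2) / 2, (x.2 - x.1) / 2)
      left_inv := by intro x; ext <;> (simp only; field_simp; ring)
      right_inv := by intro x; ext <;> (simp only; field_simp; ring) }
  have h3 : ∏ x : ZMod p × ZMod p, gg (x.1 ^ 2 - x.2 ^ 2) = (p : ℝ) ^ (p - 1) := by
    rw [← hyp]
    apply Fintype.prod_equiv e
    intro x
    simp only [e, Equiv.coe_fn_mk]
    congr 1; ring
  have hin : ∀ u : ZMod p, ∏ v ∈ univ.erase (0 : ZMod p), gg (u - v ^ 2) =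
      (∏ k ∈ Icc 1 (p / 2), gg (u - (k : ZMod p) ^ 2)) ^ 2 := by
    intro u
    rw [← prod_half_rep (by omega) (fun v => gg (u - v ^ 2)), ← prod_pow]
    apply prod_congr rfl; intro k _; simp only [neg_sq]; ring
  have hin0 : ∏ v ∈ univ.erase (0 : ZMod p), gg (0 - v ^ 2) = p := by
    rw [hin, ← prod_gg_sq hp4 (c := 1) one_ne_zero]
    congr 1
    apply prod_congr rfl; intro k _; rw [zero_sub, gg_neg, one_mul]
  have hin0' : ∏ v ∈ univ.erase (0 : ZMod p), gg (v ^ 2) = p := by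
    rw [← hin0]
    apply prod_congr rfl; intro k _; rw [zero_sub, gg_neg]
  have hout : ∏ u ∈ univ.erase (0 : ZMod p), (∏ k ∈ Icc 1 (p / 2), gg (u ^ 2 - (k : ZMod p) ^ 2)) ^ 2
      = (∏ j ∈ Icc 1 (p / 2), ∏ k ∈ Icc 1 (p / 2),
        gg ((j : ZMod p) ^ 2 - (k : ZMod p) ^ 2)) ^ 4 := by
    rw [← prod_half_rep (by omega)
      (fun u => (∏ k ∈ Icc 1 (p / 2), gg (u ^ 2 - (k : ZMod p) ^ 2)) ^ 2), ← prod_pow]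
    apply prod_congr rfl; intro k _; rw [neg_sq]; ring
  rw [Fintype.prod_prod_type] at h3
  simp only at h3
  rw [← h3]
  have : ∀ u : ZMod p, ∏ v : ZMod p, gg (u ^ 2 - v ^ 2) =
      gg (u ^ 2) * (∏ k ∈ Icc 1 (p / 2), gg (u ^ 2 - (k : ZMod p) ^ 2)) ^ 2 := by
    intro u
    rw [← hin, ← mul_prod_erase univ _ (mem_univ 0)]
    simp
  simp_rw [this]
  rw [← mul_prod_erase univ _ (mem_univ 0), prod_mul_distrib, hout, hin0']
  have h00 : (∏ k ∈ Icc 1 (p / 2), gg ((0 : ZMod p) ^ 2 - (k : ZMod p) ^ 2)) ^ 2 = p := by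
    rw [← hin, zero_pow two_ne_zero, hin0]
  rw [h00]
  simp [gg_zero]
  ring

lemma prod_gg_row (hp4 : p % 4 = 3) :
    (∏ j ∈ Icc 1 (p / 2), ∏ k ∈ Icc 1 (p / 2), gg ((j : ZMod p) ^ 2 - (k : ZMod p) ^ 2)) *
    (∏ j ∈ Icc 1 (p / 2), ∏ k ∈ Icc 1 (p / 2), gg ((j : ZMod p) ^ 2 + (k : ZMod p) ^ 2)) *
    (∏ j ∈ Icc 1 (p / 2), gg (1 * (j : ZMod p) ^ 2)) = (p : ℝ) ^ (p / 2) := by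
  rw [← prod_mul_distrib, ← prod_mul_distrib]
  have : ∀ j ∈ Icc 1 (p / 2), ((∏ k ∈ Icc 1 (p / 2), gg ((j : ZMod p) ^ 2 - (k : ZMod p) ^ 2)) *
    (∏ k ∈ Icc 1 (p / 2), gg ((j : ZMod p) ^ 2 + (k : ZMod p) ^ 2))) *
     gg (1 * (j : ZMod p) ^ 2) = p := by
    intro j _
    rw [← prod_mul_distrib]
    have h := prod_sq_rep hp4 (fun u => gg ((j : ZMod p) ^ 2 + u))
    have h2 : ∏ u : ZMod p, gg ((j : ZMod p) ^ 2 + u) = p := by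
      rw [← prod_gg_univ (p := p)]
      exact Fintype.prod_equiv (Equiv.addLeft _) _ _ (fun _ => rfl)
    rw [← mul_prod_erase univ _ (mem_univ 0), ← h] at h2
    rw [← h2, one_mul, add_zero, mul_comm]
    congr 1
    apply prod_congr rfl
    intro k _
    rw [mul_comm, sub_eq_add_neg]
  rw [prod_congr rfl this]
  simp

lemma prod_gg_key (hp4 : p % 4 = 3) :
    (∏ j ∈ Icc 1 (p / 2), ∏ k ∈ (Icc 1 (p / 2)).erase j, gg ((j : ZMod p) ^ 2 + (k : ZMod p) ^ 2))
    = ∏ j ∈ Icc 1 (p / 2), ∏ k ∈ (Icc 1 (p / 2)).erase j,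
        gg ((j : ZMod p) ^ 2 - (k : ZMod p) ^ 2) := by
  have hp := (Fact.out : p.Prime)
  have h2 : (2 : ZMod p) ≠ 0 := by
    intro h
    have : ((2 : ℕ) : ZMod p) = 0 := by exact_mod_cast h
    rw [ZMod.natCast_eq_zero_iff] at this
    have := Nat.le_of_dvd (by omega) this
    have := hp.two_le
    omega
  have h1 := prod_gg_diff hp4
  have h3 := prod_gg_row hp4
  have h4 := prod_gg_sq hp4 (c := 1) one_ne_zero
  have h5 := prod_gg_sq hp4 h2
  have e1 : (∏ j ∈ Icc 1 (p / 2), ∏ k ∈ Icc 1 (p / 2), gg ((j : ZMod p) ^ 2 - (k : ZMod p) ^ 2))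
    = ∏ j ∈ Icc 1 (p / 2), ∏ k ∈ (Icc 1 (p / 2)).erase j,
        gg ((j : ZMod p) ^ 2 - (k : ZMod p) ^ 2) := by
    apply prod_congr rfl
    intro j hj
    rw [← mul_prod_erase _ _ hj, sub_self, gg_zero, one_mul]
  have e2 : (∏ j ∈ Icc 1 (p / 2), ∏ k ∈ Icc 1 (p / 2), gg ((j : ZMod p) ^ 2 + (k : ZMod p) ^ 2))
    = (∏ j ∈ Icc 1 (p / 2), gg (2 * (j : ZMod p) ^ 2)) *
      ∏ j ∈ Icc 1 (p / 2), ∏ k ∈ (Icc 1 (p / 2)).erase j,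
        gg ((j : ZMod p) ^ 2 + (k : ZMod p) ^ 2) := by
    rw [← prod_mul_distrib]
    apply prod_congr rfl
    intro j hj
    rw [← mul_prod_erase _ _ hj, two_mul]
  rw [e2, e1] at h3
  rw [e1] at h1
  have pos1 : 0 < ∏ j ∈ Icc 1 (p / 2), gg (1 * (j : ZMod p) ^ 2) := prod_pos fun _ _ => gg_pos _
  have pos2 : 0 < ∏ j ∈ Icc 1 (p / 2), gg (2 * (j : ZMod p) ^ 2) := prod_pos fun _ _ => gg_pos _
  have pos3 : 0 < ∏ j ∈ Icc 1 (p / 2), ∏ k ∈ (Icc 1 (p / 2)).erase j,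
        gg ((j : ZMod p) ^ 2 - (k : ZMod p) ^ 2) :=
    prod_pos fun _ _ => prod_pos fun _ _ => gg_pos _
  set A := ∏ j ∈ Icc 1 (p / 2), gg (1 * (j : ZMod p) ^ 2)
  set B := ∏ j ∈ Icc 1 (p / 2), gg (2 * (j : ZMod p) ^ 2)
  set Q := ∏ j ∈ Icc 1 (p / 2), ∏ k ∈ (Icc 1 (p / 2)).erase j,
        gg ((j : ZMod p) ^ 2 - (k : ZMod p) ^ 2)
  set W := ∏ j ∈ Icc 1 (p / 2), ∏ k ∈ (Icc 1 (p / 2)).erase j,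
        gg ((j : ZMod p) ^ 2 + (k : ZMod p) ^ 2)
  have hAB : A = B := by
    have : A ^ 2 = B ^ 2 := by rw [h4, h5]
    exact (sq_eq_sq₀ pos1.le pos2.le).mp this
  have hpp : (p : ℝ) ≠ 0 := by exact_mod_cast hp.ne_zero
  have hppos : (0 : ℝ) < p := by exact_mod_cast hp.pos
  rw [← hAB] at h3
  have h6 : Q * W * p = (p : ℝ) ^ (p / 2) := by rw [← h3, ← h4]; ring
  have h7 : (Q ^ 2 * p) = (p : ℝ) ^ (p / 2) := by
    have : (Q ^ 2 * p) ^ 2 = ((p : ℝ) ^ (p / 2)) ^ 2 := by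
      rw [← pow_mul]
      have : p / 2 * 2 = p - 1 := by omega
      rw [this, ← h1]; ring
    exact (sq_eq_sq₀ (by positivity) (by positivity)).mp this
  have h8 : Q * p * W = Q * p * Q := by linear_combination h6 - h7
  exact mul_left_cancel₀ (by positivity) h8
end gg

end PartP1

section PartP3
open Finset

section cauchy

lemma cauchy_poly_det {F : Type*} [Field F] {N : ℕ} (z y : Fin N → F) :
    Matrix.det (Matrix.of fun j k : Fin N => ∏ i ∈ univ.erase j, (z k - y i)) *
      (Matrix.vandermonde y).det =
    (Matrix.vandermonde z).det * ∏ j, ∏ i ∈ univ.erase j, (y j - y i) := by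
  classical
  let P : Fin N → Polynomial F := fun j => ∏ i ∈ univ.erase j, (Polynomial.X - Polynomial.C (y i))
  have hdeg : ∀ j, (P j).natDegree < N := by
    intro j
    have hN : 0 < N := Fin.pos j
    have : (P j).natDegree = ∑ i ∈ univ.erase j, 1 := by
      rw [Polynomial.natDegree_prod _ _ (fun i _ => Polynomial.X_sub_C_ne_zero _)]
      apply sum_congr rfl; intro i _; exact Polynomial.natDegree_X_sub_C _
    rw [this]
    simp [card_erase_of_mem]
    omega
  have heval : ∀ j x, (P j).eval x = ∏ i ∈ univ.erase j, (x - y i) := by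
    intro j x
    simp [P, Polynomial.eval_prod]
  let B : Matrix (Fin N) (Fin N) F := Matrix.of fun j m => (P j).coeff m
  have hB : ∀ w : Fin N → F, Matrix.det (Matrix.of fun j k : Fin N => ∏ i ∈ univ.erase j, (w k - y i))
      = B.det * (Matrix.vandermonde w).det := by
    intro w
    rw [← Matrix.det_transpose (Matrix.vandermonde w), ← Matrix.det_mul]
    congr 1
    ext j k
    rw [Matrix.of_apply, ← heval, Polynomial.eval_eq_sum_range' (hdeg j), Matrix.mul_apply,
      ← Fin.sum_univ_eq_sum_range (fun m => (P j).coeff m * w k ^ m)]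
    simp [B, Matrix.vandermonde_apply]
  have hy : Matrix.det (Matrix.of fun j k : Fin N => ∏ i ∈ univ.erase j, (y k - y i)) =
      ∏ j, ∏ i ∈ univ.erase j, (y j - y i) := by
    have : (Matrix.of fun j k : Fin N => ∏ i ∈ univ.erase j, (y k - y i)) =
        Matrix.diagonal (fun j => ∏ i ∈ univ.erase j, (y j - y i)) := by
      ext j k
      rw [Matrix.of_apply, Matrix.diagonal_apply]
      split_ifs with h
      · rw [h]
      · apply prod_eq_zero (i := k)
        · simp [Ne.symm h]
        · simp
    rw [this, Matrix.det_diagonal]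
  rw [← hy, hB z, hB y]
  ring

/-- off-diagonal products -/
lemma offdiag_prod {M : Type*} [CommMonoid M] {n : ℕ} (f : Fin n → Fin n → M) :
    ∏ j, ∏ i ∈ univ.erase j, f j i = ∏ i, ∏ j ∈ Ioi i, (f i j * f j i) := by
  have := prod_prod_Ioi_mul_eq_prod_prod_off_diag (fun i j => f j i)
  rw [this]
  apply prod_congr rfl; intro j _
  apply prod_congr _ (fun _ _ => rfl)
  ext i; simp

/-- Structural evaluation of a bordered Cauchy determinant. -/
lemma bordered_cauchy {n : ℕ} (w : Fin n → ℂ) (hw : ∀ i, ‖w i‖ = 1)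
    (hinj : Function.Injective w) (hne1 : ∀ i, w i ≠ 1)
    (hdis : ∀ i j, w i * w j ≠ 1) (hprod : ∏ i, w i = 1) (c : ℂ) :
    Matrix.det (Matrix.of fun j k : Fin (n + 1) =>
      (Fin.cases 1 (fun j' : Fin n => c * (Fin.cons 1 w : Fin (n + 1) → ℂ) k /
        ((Fin.cons 1 w : Fin (n + 1) → ℂ) k - (w j')⁻¹)) j : ℂ)) *
      (∏ i, (w i - (w i)⁻¹)) * ∏ i, ∏ j ∈ Ioi i, ((‖w i - (w j)⁻¹‖ : ℂ) ^ 2)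
    = (-1) ^ n * c ^ n * ∏ i, ∏ j ∈ Ioi i, ((‖w i - w j‖ : ℂ) ^ 2) := by
  have hw0 : ∀ i, w i ≠ 0 := fun i h => by have := hw i; rw [h] at this; simp at this
  have hconj : ∀ i, (w i)⁻¹ = (starRingEnd ℂ) (w i) := by
    intro i
    rw [Complex.inv_def, Complex.normSq_eq_norm_sq, hw]; simp
  set z : Fin (n + 1) → ℂ := Fin.cons 1 w with hz
  set y : Fin (n + 1) → ℂ := Fin.cons 0 (fun i => (w i)⁻¹) with hy
  have hz0 : ∀ k, z k ≠ 0 := by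
    intro k; refine Fin.cases ?_ ?_ k
    · simp [hz]
    · intro i; simpa [hz] using hw0 i
  have hzy : ∀ k i, z k - y i ≠ 0 := by
    intro k i
    refine Fin.cases ?_ ?_ i
    · simpa [hy] using hz0 k
    · intro i
      refine Fin.cases ?_ ?_ k
      · simp only [hz, hy, Fin.cons_zero, Fin.cons_succ]
        rw [sub_ne_zero]; intro h
        exact hne1 i (by rw [← inv_inv (w i), ← h, inv_one])
      · intro k
        simp only [hz, hy, Fin.cons_succ]
        rw [sub_ne_zero]; intro h
        exact hdis k i (by rw [h]; exact inv_mul_cancel₀ (hw0 i))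
  have hM : (Matrix.of fun j k : Fin (n + 1) =>
      (Fin.cases 1 (fun j' : Fin n => c * z k / (z k - (w j')⁻¹)) j : ℂ)) =
      Matrix.of fun j k => (Fin.cons 1 (fun _ => c) : Fin (n + 1) → ℂ) j *
        (Matrix.of fun j k => (z k * (∏ i, (z k - y i))⁻¹) *
          (Matrix.of fun j k : Fin (n + 1) => ∏ i ∈ univ.erase j, (z k - y i)) j k) j k := by
    ext j k
    simp only [Matrix.of_apply]
    rw [← mul_prod_erase univ (fun i => z k - y i) (mem_univ j)]
    have h1 : ∏ i ∈ univ.erase j, (z k - y i) ≠ 0 := prod_ne_zero_iff.mpr fun i _ => hzy k i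
    have h2 := hzy k j
    have h3 := hz0 k
    revert h2 h1
    refine Fin.cases ?_ ?_ j
    · intro h1 h2
      simp only [Fin.cases_zero, Fin.cons_zero]
      have : y 0 = 0 := by simp [hy]
      rw [this] at h2 ⊢
      rw [sub_zero] at h2 ⊢
      field_simp
    · intro j h1 h2
      simp only [Fin.cases_succ, Fin.cons_succ]
      have : y j.succ = (w j)⁻¹ := by simp [hy]
      rw [this] at h2 ⊢
      have := hw0 j
      rw [mul_inv]
      field_simp
  rw [hM, Matrix.det_mul_column, Matrix.det_mul_row]
  have hcp := cauchy_poly_det z y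
  set DD := Matrix.det (Matrix.of fun j k : Fin (n + 1) => ∏ i ∈ univ.erase j, (z k - y i))
  have hVy : (Matrix.vandermonde y).det = ∏ i, ∏ j ∈ Ioi i, ((w j)⁻¹ - (w i)⁻¹) := by
    rw [Matrix.det_vandermonde, Fin.prod_univ_succ, Fin.prod_Ioi_zero]
    simp only [hy, Fin.prod_Ioi_succ, Fin.cons_zero, Fin.cons_succ, sub_zero]
    rw [prod_inv_distrib, hprod]; simp
  have hVz : (Matrix.vandermonde z).det = (∏ i, (w i - 1)) * ∏ i, ∏ j ∈ Ioi i, (w j - w i) := by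
    rw [Matrix.det_vandermonde, Fin.prod_univ_succ, Fin.prod_Ioi_zero]
    simp only [hz, Fin.prod_Ioi_succ, Fin.cons_zero, Fin.cons_succ]
  have hyy : ∏ j, ∏ i ∈ univ.erase j, (y j - y i) =
      (-1) ^ n * ∏ i, ∏ j ∈ Ioi i, (((w i)⁻¹ - (w j)⁻¹) * ((w j)⁻¹ - (w i)⁻¹)) := by
    rw [offdiag_prod (fun j i => y j - y i), Fin.prod_univ_succ, Fin.prod_Ioi_zero]
    simp only [hy, Fin.prod_Ioi_succ, Fin.cons_zero, Fin.cons_succ, sub_zero, zero_sub, neg_mul]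
    congr 1
    have : ∀ x : Fin n, -((w x)⁻¹ * (w x)⁻¹) = (-1) * ((w x)⁻¹ * (w x)⁻¹) := fun x => by ring
    simp_rw [this]
    rw [prod_mul_distrib, prod_mul_distrib, prod_inv_distrib, hprod]; simp
  have hzyp : ∏ k, ∏ i, (z k - y i) = (∏ i, (w i - 1)) * (∏ i, (w i - (w i)⁻¹)) *
      ∏ i, ∏ j ∈ Ioi i, ((w i - (w j)⁻¹) * (w j - (w i)⁻¹)) := by
    rw [Fin.prod_univ_succ]
    simp only [hz, hy, Fin.prod_univ_succ, Fin.cons_zero, Fin.cons_succ, sub_zero, one_mul]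
    rw [prod_mul_distrib, hprod, one_mul]
    have h1 : ∏ i, (1 - (w i)⁻¹) = ∏ i, (w i - 1) := by
      have : ∀ i, (1 - (w i)⁻¹) = (w i - 1) * (w i)⁻¹ := by
        intro i; have := hw0 i; field_simp
      simp_rw [this]
      rw [prod_mul_distrib, prod_inv_distrib, hprod]; simp
    rw [h1, mul_assoc]
    congr 1
    rw [← offdiag_prod (fun j i => w j - (w i)⁻¹), ← prod_mul_distrib]
    apply prod_congr rfl
    intro i _
    rw [mul_prod_erase univ (fun j => w i - (w j)⁻¹) (mem_univ i)]
  have hzp : ∏ k, z k = 1 := by rw [Fin.prod_univ_succ]; simp [hz, hprod]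
  have hcc : ∏ k, (Fin.cons 1 (fun _ => c) : Fin (n + 1) → ℂ) k = c ^ n := by
    rw [Fin.prod_univ_succ]; simp
  rw [hcc, prod_mul_distrib, hzp, prod_inv_distrib, hzyp]
  rw [hVy, hVz, hyy] at hcp
  -- pairwise products
  have hs1 : ∏ i, ∏ j ∈ Ioi i, ((w i - (w j)⁻¹) * (w j - (w i)⁻¹)) =
      (∏ i : Fin n, ∏ j ∈ Ioi i, (-1 : ℂ)) * ∏ i, ∏ j ∈ Ioi i, ((‖w i - (w j)⁻¹‖ : ℂ) ^ 2) := by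
    simp_rw [← prod_mul_distrib]
    refine prod_congr rfl fun i _ => prod_congr rfl fun j _ => ?_
    rw [← Complex.conj_mul', map_sub, hconj j, Complex.conj_conj, hconj i]
    ring
  have hs2 : ∏ i, ∏ j ∈ Ioi i, (((w i)⁻¹ - (w j)⁻¹) * ((w j)⁻¹ - (w i)⁻¹)) =
      (∏ i : Fin n, ∏ j ∈ Ioi i, (-1 : ℂ)) * (∏ i, ∏ j ∈ Ioi i, ((w j)⁻¹ - (w i)⁻¹)) *
       ∏ i, ∏ j ∈ Ioi i, ((w j)⁻¹ - (w i)⁻¹) := by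
    simp_rw [← prod_mul_distrib]
    refine prod_congr rfl fun i _ => prod_congr rfl fun j _ => ?_
    ring
  have hs3 : (∏ i, ∏ j ∈ Ioi i, (w j - w i)) * (∏ i, ∏ j ∈ Ioi i, ((w j)⁻¹ - (w i)⁻¹)) =
      ∏ i, ∏ j ∈ Ioi i, ((‖w i - w j‖ : ℂ) ^ 2) := by
    simp_rw [← prod_mul_distrib]
    refine prod_congr rfl fun i _ => prod_congr rfl fun j _ => ?_
    rw [← Complex.conj_mul', map_sub, hconj j, hconj i]
    ring
  have hV0 : (∏ i, ∏ j ∈ Ioi i, ((w j)⁻¹ - (w i)⁻¹)) ≠ 0 := by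
    refine prod_ne_zero_iff.mpr fun i _ => prod_ne_zero_iff.mpr fun j hj => ?_
    rw [sub_ne_zero]
    intro h
    have := hinj (inv_injective h)
    rw [mem_Ioi] at hj
    exact absurd this hj.ne'
  have hm0 : (∏ i : Fin n, ∏ j ∈ Ioi i, (-1 : ℂ)) ≠ 0 :=
    prod_ne_zero_iff.mpr fun i _ => prod_ne_zero_iff.mpr fun j hj => by norm_num
  have hw10 : (∏ i, (w i - 1)) ≠ 0 := prod_ne_zero_iff.mpr fun i _ => sub_ne_zero.mpr (hne1 i)
  have hww0 : (∏ i, (w i - (w i)⁻¹)) ≠ 0 := prod_ne_zero_iff.mpr fun i _ => by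
    rw [sub_ne_zero]; intro h; apply hdis i i; nth_rewrite 1 [h]; exact inv_mul_cancel₀ (hw0 i)
  have hN0 : ∏ i, ∏ j ∈ Ioi i, ((‖w i - (w j)⁻¹‖ : ℂ) ^ 2) ≠ 0 := by
    refine prod_ne_zero_iff.mpr fun i _ => prod_ne_zero_iff.mpr fun j hj => ?_
    apply pow_ne_zero
    simp only [ne_eq, Complex.ofReal_eq_zero, norm_eq_zero]
    rw [sub_eq_zero]; intro h; exact hdis i j (by rw [h]; exact inv_mul_cancel₀ (hw0 j))
  rw [hs2] at hcp
  have hcp2 : DD = (∏ i, (w i - 1)) * ((-1) ^ n * (∏ i : Fin n, ∏ j ∈ Ioi i, (-1 : ℂ)) *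
      ∏ i, ∏ j ∈ Ioi i, ((‖w i - w j‖ : ℂ) ^ 2)) := by
    apply mul_right_cancel₀ hV0
    rw [hcp, ← hs3]
    ring
  rw [hcp2, hs1]
  clear_value DD
  clear hs1 hs2 hs3 hcp hcp2 hyy hzyp hVy hVz
  generalize (∏ i, (w i - 1)) = a1 at *
  generalize (∏ i, (w i - (w i)⁻¹)) = a2 at *
  generalize (∏ i : Fin n, ∏ j ∈ Ioi i, (-1 : ℂ)) = a3 at *
  generalize ∏ i, ∏ j ∈ Ioi i, ((‖w i - (w j)⁻¹‖ : ℂ) ^ 2) = a4 at *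
  generalize ∏ i, ∏ j ∈ Ioi i, ((‖w i - w j‖ : ℂ) ^ 2) = a5 at *
  field_simp
end cauchy

end PartP3

section PartP4
open Finset

section DC
variable {p : ℕ} [Fact p.Prime]

/-- Complex form of the cotangent. -/
noncomputable def ctc (u : ZMod p) : ℂ :=
  Complex.I * (ZMod.stdAddChar u + 1) / (ZMod.stdAddChar u - 1)

lemma ctc_eq (m : ℤ) :
    ((Real.cot (Real.pi * (m : ℝ) / p) : ℝ) : ℂ) = ctc (m : ZMod p) := by
  unfold ctc
  rw [ZMod.stdAddChar_coe, Real.cot_eq_cos_div_sin, Complex.ofReal_div, Complex.ofReal_cos,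
    Complex.ofReal_sin]
  set x : ℂ := ((Real.pi * (m : ℝ) / p : ℝ) : ℂ) with hx
  have he : 2 * (Real.pi : ℂ) * Complex.I * (m : ℂ) / (p : ℂ) = x * Complex.I + x * Complex.I := by
    rw [hx]; push_cast; ring
  rw [he, Complex.exp_add]
  have hcos : Complex.cos x = (Complex.exp (x * Complex.I) + Complex.exp (-x * Complex.I)) / 2 := rfl
  have hsin : Complex.sin x =
    (Complex.exp (-x * Complex.I) - Complex.exp (x * Complex.I)) * Complex.I / 2 := rfl
  rw [hcos, hsin, neg_mul, Complex.exp_neg]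
  have h0 := Complex.exp_ne_zero (x * Complex.I)
  set E := Complex.exp (x * Complex.I)
  by_cases h : E * E - 1 = 0
  · have : E⁻¹ - E = 0 := by
      field_simp
      linear_combination -h
    rw [h, this]; simp
  · have h2 : 1 - E ^ 2 ≠ 0 := by
      intro h3; apply h; linear_combination -h3
    have h3 : E ^ 2 - 1 ≠ 0 := by
      intro h3; apply h; linear_combination h3
    have h4 : E⁻¹ - E = (1 - E ^ 2) * E⁻¹ := by field_simp
    have h5 : E * E - 1 = E ^ 2 - 1 := by ring
    rw [h4, h5]
    field_simp
    rw [Complex.I_sq]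
    ring

lemma ctc_neg (u : ZMod p) : ctc (-u) = - ctc u := by
  unfold ctc
  rw [AddChar.map_neg_eq_inv]
  have h0 : (ZMod.stdAddChar u : ℂ) ≠ 0 := by
    intro h; have := norm_stdAddChar' u; rw [h] at this; simp at this
  set E : ℂ := ZMod.stdAddChar u
  by_cases h : E - 1 = 0
  · have : E = 1 := by linear_combination h
    rw [this]; simp
  · have h1 : E⁻¹ - 1 = -(E - 1) * E⁻¹ := by field_simp; ring
    have h2 : E⁻¹ + 1 = (E + 1) * E⁻¹ := by field_simp; ring
    rw [h1, h2]
    field_simp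

/-- The determinant, in complex form, with parameters modulo `p`. -/
noncomputable def DC (p : ℕ) [Fact p.Prime] (a b : ZMod p) : ℂ :=
  Matrix.det (Matrix.of fun j k : Fin (p / 2 + 1) =>
    if (j : ℕ) = 0 then (1 : ℂ) else ctc (a * ((j : ℕ) : ZMod p) ^ 2 + b * ((k : ℕ) : ZMod p) ^ 2))

lemma exists_perm (hodd : p % 2 = 1) {d : ZMod p} (hd : d ≠ 0) :
    ∃ σ : Equiv.Perm (Fin (p / 2 + 1)),
      ∀ k, (((σ k : Fin (p / 2 + 1)) : ℕ) : ZMod p) ^ 2 = d ^ 2 * ((k : ℕ) : ZMod p) ^ 2 := by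
  have hex : ∀ k : Fin (p / 2 + 1), ∃ k' : Fin (p / 2 + 1),
      ((k' : ℕ) : ZMod p) ^ 2 = d ^ 2 * ((k : ℕ) : ZMod p) ^ 2 := by
    intro k
    obtain ⟨j, hj, hj2⟩ := exists_half_rep (d * ((k : ℕ) : ZMod p))
    refine ⟨⟨j, by omega⟩, ?_⟩
    rw [← mul_pow]
    rcases hj2 with h | h <;> rw [h] <;> ring
  choose s hs using hex
  have hinj : Function.Injective s := by
    intro a b hab
    have h1 := hs a
    rw [hab, hs b] at h1
    have h2 := mul_left_cancel₀ (pow_ne_zero 2 hd) h1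
    have := half_sq_inj (by omega) (by omega) hodd h2
    exact Fin.ext this.symm
  exact ⟨Equiv.ofBijective s (Finite.injective_iff_bijective.mp hinj), hs⟩

lemma DC_col (hodd : p % 2 = 1) (a b : ZMod p) {d : ZMod p} (hd : d ≠ 0) :
    DC p a (b * d ^ 4) = DC p a b := by
  obtain ⟨σ, hσ⟩ := exists_perm hodd hd
  have key : ∀ b, DC p a (b * d ^ 2) = (Equiv.Perm.sign σ : ℂ) * DC p a b := by
    intro b
    unfold DC
    rw [← Matrix.det_permute']
    congr 1
    ext j k
    simp only [Matrix.of_apply, Matrix.submatrix_apply, id, hσ]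
    ring_nf
  have : b * d ^ 4 = (b * d ^ 2) * d ^ 2 := by ring
  rw [this, key, key, ← mul_assoc]
  have : (Equiv.Perm.sign σ : ℂ) * (Equiv.Perm.sign σ : ℂ) = 1 := by
    rcases Int.units_eq_one_or (Equiv.Perm.sign σ) with h | h <;> rw [h] <;> simp
  rw [this, one_mul]

lemma DC_row (hodd : p % 2 = 1) (a b : ZMod p) {d : ZMod p} (hd : d ≠ 0) :
    DC p (a * d ^ 4) b = DC p a b := by
  obtain ⟨σ, hσ⟩ := exists_perm hodd hd
  have h0 : ∀ j, ((σ j : Fin (p / 2 + 1)) : ℕ) = 0 ↔ (j : ℕ) = 0 := by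
    have h00 : σ 0 = 0 := by
      have h := hσ 0
      simp only [Fin.val_zero, Nat.cast_zero] at h
      have h2 := half_sq_inj (j := ((σ 0 : Fin (p / 2 + 1)) : ℕ)) (k := 0) (by omega) (by omega) hodd
        (by rw [h]; simp)
      exact Fin.ext h2
    intro j
    constructor
    · intro h
      have : σ j = σ 0 := by rw [h00]; exact Fin.ext h
      have := σ.injective this
      rw [this]; rfl
    · intro h
      have : j = 0 := Fin.ext h
      rw [this, h00]; rfl
  have key : ∀ a, DC p (a * d ^ 2) b = (Equiv.Perm.sign σ : ℂ) * DC p a b := by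
    intro a
    unfold DC
    rw [← Matrix.det_permute]
    congr 1
    ext j k
    simp only [Matrix.of_apply, Matrix.submatrix_apply, id, hσ, h0]
    ring_nf
  have : a * d ^ 4 = (a * d ^ 2) * d ^ 2 := by ring
  rw [this, key, key, ← mul_assoc]
  have : (Equiv.Perm.sign σ : ℂ) * (Equiv.Perm.sign σ : ℂ) = 1 := by
    rcases Int.units_eq_one_or (Equiv.Perm.sign σ) with h | h <;> rw [h] <;> simp
  rw [this, one_mul]

lemma DC_neg (hp4 : p % 4 = 3) : DC p (-1) (-1) = - DC p 1 1 := by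
  have h1 : (∏ j : Fin (p / 2 + 1), (if (j : ℕ) = 0 then (1 : ℂ) else -1)) = -1 := by
    rw [Fin.prod_univ_succ]
    simp only [Fin.val_zero, if_true, Fin.val_succ, Nat.succ_ne_zero, if_false, prod_const,
      card_univ, Fintype.card_fin, one_mul]
    exact Odd.neg_one_pow (Nat.odd_iff.mpr (by omega))
  unfold DC
  rw [← neg_one_mul (Matrix.det _), ← h1, ← Matrix.det_mul_column]
  congr 1
  ext j k
  simp only [Matrix.of_apply]
  split_ifs with h
  · simp
  · rw [neg_one_mul (ctc _), ← ctc_neg]; congr 1; ring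

lemma exists_fourth (hp4 : p % 4 = 3) {u : ZMod p} (hu : u ≠ 0) (hs : IsSquare u) :
    ∃ d : ZMod p, d ≠ 0 ∧ u = d ^ 4 := by
  obtain ⟨y, hy⟩ := hs
  have hy0 : y ≠ 0 := by rintro rfl; simp at hy; exact hu hy
  have h : IsSquare y ∨ IsSquare (-y) := by
    rcases quadraticChar_dichotomy hy0 with h | h
    · left; exact (quadraticChar_one_iff_isSquare hy0).mp h
    · right
      rw [← quadraticChar_one_iff_isSquare (neg_ne_zero.mpr hy0), ← neg_one_mul, map_mul, h,
        (quadraticChar_neg_one_iff_not_isSquare).mpr (neg_one_not_square hp4)]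
      norm_num
  rcases h with ⟨d, hd⟩ | ⟨d, hd⟩
  · refine ⟨d, ?_, ?_⟩
    · rintro rfl; simp at hd; exact hy0 hd
    · rw [hy, hd]; ring
  · refine ⟨d, ?_, ?_⟩
    · rintro rfl; simp at hd; exact hy0 hd
    · have : y = - (d * d) := by rw [← hd]; ring
      rw [hy, this]; ring

lemma DC_general (hp4 : p % 4 = 3) {a b : ZMod p} (hab : quadraticChar (ZMod p) (-(a * b)) = -1) :
    DC p a b = (quadraticChar (ZMod p) a : ℂ) * DC p 1 1 := by
  have hm1 : quadraticChar (ZMod p) (-1) = -1 :=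
    (quadraticChar_neg_one_iff_not_isSquare).mpr (neg_one_not_square hp4)
  have ha : a ≠ 0 := by rintro rfl; simp at hab
  have hb : b ≠ 0 := by rintro rfl; simp at hab
  rw [← neg_one_mul, map_mul, map_mul, hm1] at hab
  have hodd : p % 2 = 1 := by omega
  rcases quadraticChar_dichotomy ha with h | h
  · have h2 : quadraticChar (ZMod p) b = 1 := by rw [h] at hab; linarith
    obtain ⟨d, hd, rfl⟩ := exists_fourth hp4 ha ((quadraticChar_one_iff_isSquare ha).mp h)
    obtain ⟨e, he, rfl⟩ := exists_fourth hp4 hb ((quadraticChar_one_iff_isSquare hb).mp h2)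
    rw [h, ← one_mul (d ^ 4), ← one_mul (e ^ 4), DC_col hodd _ _ he, DC_row hodd _ _ hd]
    simp
  · have h2 : quadraticChar (ZMod p) b = -1 := by rw [h] at hab; linarith
    have h3 : quadraticChar (ZMod p) (-a) = 1 := by rw [← neg_one_mul, map_mul, h, hm1]; norm_num
    have h4 : quadraticChar (ZMod p) (-b) = 1 := by rw [← neg_one_mul, map_mul, h2, hm1]; norm_num
    obtain ⟨d, hd, hd2⟩ := exists_fourth hp4 (neg_ne_zero.mpr ha)
      ((quadraticChar_one_iff_isSquare (neg_ne_zero.mpr ha)).mp h3)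
    obtain ⟨e, he, he2⟩ := exists_fourth hp4 (neg_ne_zero.mpr hb)
      ((quadraticChar_one_iff_isSquare (neg_ne_zero.mpr hb)).mp h4)
    have ea : a = -1 * d ^ 4 := by rw [← hd2]; ring
    have eb : b = -1 * e ^ 4 := by rw [← he2]; ring
    rw [h, ea, eb, DC_col hodd _ _ he, DC_row hodd _ _ hd, DC_neg hp4]
    simp
end DC

end PartP4

section PartP5
open Finset

section DC11
variable {p : ℕ} [Fact p.Prime]

lemma stdAddChar_im (k : ℤ) :
    (ZMod.stdAddChar (k : ZMod p) : ℂ).im = Real.sin (2 * Real.pi * k / p) := by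
  rw [ZMod.stdAddChar_coe]
  have : 2 * (Real.pi : ℂ) * Complex.I * (k : ℂ) / (p : ℂ) =
    ((2 * Real.pi * k / p : ℝ) : ℂ) * Complex.I := by push_cast; ring
  rw [this, Complex.exp_ofReal_mul_I_im]

lemma im_neg (u : ZMod p) : (ZMod.stdAddChar (-u) : ℂ).im = - (ZMod.stdAddChar u : ℂ).im := by
  rw [← conj_stdAddChar, Complex.conj_im]

lemma sub_inv_eq_im (u : ZMod p) :
    (ZMod.stdAddChar u : ℂ) - (ZMod.stdAddChar u)⁻¹ =
      Complex.I * ((2 * (ZMod.stdAddChar u : ℂ).im : ℝ) : ℂ) := by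
  rw [← AddChar.map_neg_eq_inv, ← conj_stdAddChar, Complex.sub_conj]
  push_cast; ring

lemma im_pos_of_mem_half {k : ℕ} (hp : p % 2 = 1) (hk : k ∈ Icc 1 (p / 2)) :
    0 < (ZMod.stdAddChar (k : ZMod p) : ℂ).im := by
  have h := stdAddChar_im (p := p) (k : ℤ)
  push_cast at h
  rw [h]
  rw [mem_Icc] at hk
  have hk1 : (1 : ℝ) ≤ k := by exact_mod_cast hk.1
  have hk2 : 2 * (k : ℝ) < p := by
    have : 2 * k < p := by omega
    exact_mod_cast this
  have hpp : (0 : ℝ) < p := by linarith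
  apply Real.sin_pos_of_pos_of_lt_pi
  · positivity
  · rw [div_lt_iff₀ hpp]
    nlinarith [Real.pi_pos]

lemma R_T_eq (hp4 : p % 4 = 3) :
    ∏ j ∈ Icc 1 (p / 2), (2 * (ZMod.stdAddChar ((j : ZMod p) ^ 2) : ℂ).im) =
    ((∏ k ∈ Icc 1 (p / 2), quadraticChar (ZMod p) (k : ZMod p) : ℤ) : ℝ) * Real.sqrt p ∧
    ∏ k ∈ Icc 1 (p / 2), (2 * (ZMod.stdAddChar (k : ZMod p) : ℂ).im) = Real.sqrt p := by
  have hp := (Fact.out : p.Prime)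
  have h2 : (2 : ZMod p) ≠ 0 := by
    intro h
    have : ((2 : ℕ) : ZMod p) = 0 := by exact_mod_cast h
    rw [ZMod.natCast_eq_zero_iff] at this
    have := Nat.le_of_dvd (by omega) this
    have := hp.two_le
    omega
  set χ := quadraticChar (ZMod p)
  have h1 := prod_chi_rep hp4 (fun u => 2 * (ZMod.stdAddChar u : ℂ).im)
  have h3 : ∀ k ∈ Icc 1 (p / 2),
      2 * (ZMod.stdAddChar (((χ (k : ZMod p) : ℤ) : ZMod p) * (k : ZMod p)) : ℂ).im =
      ((χ (k : ZMod p) : ℤ) : ℝ) * (2 * (ZMod.stdAddChar (k : ZMod p) : ℂ).im) := by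
    intro k hk
    rcases quadraticChar_dichotomy (cast_ne_zero_of_mem_half hk) with h | h
    · simp [χ, h]
    · simp [χ, h, im_neg]
  have h1 := h1.trans ((prod_congr rfl h3).trans prod_mul_distrib)
  have hpos : 0 < ∏ k ∈ Icc 1 (p / 2), (2 * (ZMod.stdAddChar (k : ZMod p) : ℂ).im) :=
    prod_pos fun k hk => by
      have := im_pos_of_mem_half (by omega) hk
      linarith
  set T := ∏ k ∈ Icc 1 (p / 2), (2 * (ZMod.stdAddChar (k : ZMod p) : ℂ).im)
  set R := ∏ j ∈ Icc 1 (p / 2), (2 * (ZMod.stdAddChar ((j : ZMod p) ^ 2) : ℂ).im) with hR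
  have hchi : (∏ k ∈ Icc 1 (p / 2), ((χ (k : ZMod p) : ℤ) : ℝ)) ^ 2 = 1 := by
    rw [← prod_pow]
    apply prod_eq_one
    intro k hk
    have : χ (k : ZMod p) ^ 2 = 1 := quadraticChar_sq_one (cast_ne_zero_of_mem_half hk)
    exact_mod_cast this
  have hRR : R ^ 2 = p := by
    rw [← prod_gg_sq hp4 h2, ← sq_abs, hR, abs_prod]
    congr 1
    apply prod_congr rfl
    intro j hj
    have hne : (j : ZMod p) ^ 2 ≠ - (j : ZMod p) ^ 2 :=
      sq_ne_neg_sq hp4 (cast_ne_zero_of_mem_half hj)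
    have h5 := norm_sub_stdAddChar hne
    have h6 : (j : ZMod p) ^ 2 - - (j : ZMod p) ^ 2 = 2 * (j : ZMod p) ^ 2 := by ring
    rw [h6, AddChar.map_neg_eq_inv, sub_inv_eq_im, norm_mul, Complex.norm_I, one_mul,
      Complex.norm_real, Real.norm_eq_abs] at h5
    exact h5
  have hTT : T ^ 2 = p := by
    rw [← hRR, h1, mul_pow, hchi, one_mul]
  have hT : T = Real.sqrt p := by rw [← hTT, Real.sqrt_sq hpos.le]
  refine ⟨?_, hT⟩
  rw [h1, hT]
  push_cast
  rfl


lemma R_eq (hp4 : p % 4 = 3) :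
    ∏ j ∈ Icc 1 (p / 2), (2 * (ZMod.stdAddChar ((j : ZMod p) ^ 2) : ℂ).im) =
    ((∏ k ∈ Icc 1 (p / 2), quadraticChar (ZMod p) (k : ZMod p) : ℤ) : ℝ) * Real.sqrt p :=
  (R_T_eq hp4).1

lemma prod_fin_Icc {M : Type*} [CommMonoid M] (n : ℕ) (f : ℕ → M) :
    ∏ i : Fin n, f (i + 1) = ∏ j ∈ Icc 1 n, f j := by
  rw [Fin.prod_univ_eq_prod_range (fun i => f (i + 1)) n]
  induction n with
  | zero => simp
  | succ n ih => rw [prod_range_succ, ih, Finset.prod_Icc_succ_top (by omega)]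
lemma six_sum (n : ℕ) : 6 * ∑ j ∈ Icc 1 n, j ^ 2 = n * (n + 1) * (2 * n + 1) := by
  induction n with
  | zero => simp
  | succ n ih => rw [Finset.sum_Icc_succ_top (by omega), mul_add, ih]; ring
lemma sum_sq_half (hp : 3 < p) : ((∑ j ∈ Icc 1 (p / 2), j ^ 2 : ℕ) : ZMod p) = 0 := by
  have hpp := (Fact.out : p.Prime)
  have hodd : 2 * (p / 2) + 1 = p := by
    rcases hpp.eq_two_or_odd with h | h <;> omega
  have h := six_sum (p / 2)
  rw [hodd] at h
  rw [ZMod.natCast_eq_zero_iff]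
  have h6 : p ∣ 6 * ∑ j ∈ Icc 1 (p / 2), j ^ 2 := h ▸ Dvd.intro_left _ rfl
  refine (Nat.Coprime.dvd_of_dvd_mul_left ?_ h6)
  rw [show 6 = 2 * 3 from rfl]
  refine Nat.Coprime.mul_right ?_ ?_
  · exact (Nat.coprime_primes hpp Nat.prime_two).2 (by omega)
  · exact (Nat.coprime_primes hpp Nat.prime_three).2 (by omega)

lemma prod_fin_Icc_erase {M : Type*} [CommMonoid M] (n : ℕ) (F : ℕ → ℕ → M) :
    ∏ i : Fin n, ∏ j ∈ univ.erase i, F (i + 1) (j + 1) =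
      ∏ j ∈ Icc 1 n, ∏ k ∈ (Icc 1 n).erase j, F j k := by
  have h1 : ∀ i : Fin n, ∏ j ∈ univ.erase i, F (i + 1) (j + 1) =
      ∏ k ∈ (Icc 1 n).erase ((i : ℕ) + 1), F (i + 1) k := by
    intro i
    have h2 := prod_fin_Icc n (fun k => if k ≠ (i : ℕ) + 1 then F (i + 1) k else 1)
    rw [← prod_filter, ← prod_filter] at h2
    convert h2 using 2
    · ext j; simp [Fin.ext_iff]
    · ext k; simp; tauto
  rw [prod_congr rfl (fun i _ => h1 i)]
  exact prod_fin_Icc n (fun j => ∏ k ∈ (Icc 1 n).erase j, F j k)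

lemma DC11 (hp : 3 < p) (hp4 : p % 4 = 3) :
    DC p 1 1 * ((∏ k ∈ Icc 1 (p / 2), quadraticChar (ZMod p) (k : ZMod p) : ℤ) : ℂ)
      * (Real.sqrt p : ℂ) = - 2 ^ (p / 2) := by
  set n := p / 2 with hn
  set sq : Fin n → ZMod p := fun i => (((i : ℕ) + 1 : ℕ) : ZMod p) ^ 2 with hsq
  set w : Fin n → ℂ := fun i => ZMod.stdAddChar (sq i) with hw
  have hmem : ∀ i : Fin n, (i : ℕ) + 1 ∈ Icc 1 (p / 2) := fun i => by
    have := i.2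
    rw [mem_Icc]; omega
  have hsq_inj : Function.Injective sq := by
    intro i j h
    have := half_sq_inj (mem_Icc.1 (hmem i)).2 (mem_Icc.1 (hmem j)).2 (by omega) h
    ext; omega
  have hsq_ne : ∀ i, sq i ≠ 0 := fun i => pow_ne_zero 2 (cast_ne_zero_of_mem_half (hmem i))
  have hsq_add : ∀ i j, sq i ≠ - sq j := fun i j =>
    sq_ne_neg_sq hp4 (cast_ne_zero_of_mem_half (hmem j))
  have hinj : Function.Injective (ZMod.stdAddChar (N := p)) := ZMod.injective_stdAddChar
  have hne1 : ∀ u : ZMod p, u ≠ 0 → (ZMod.stdAddChar u : ℂ) ≠ 1 := fun u hu h => hu (hinj (by simpa using h))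
  have hbc := bordered_cauchy w (fun i => norm_stdAddChar' _) (hinj.comp hsq_inj)
    (fun i => hne1 _ (hsq_ne i)) (fun i j => by
      rw [hw]
      simp only [← AddChar.map_add_eq_mul]
      exact hne1 _ (fun h => hsq_add i j (eq_neg_of_add_eq_zero_left h)))
    (by
      have h1 : ∀ s : Finset (Fin n), ∏ i ∈ s, w i = ZMod.stdAddChar (∑ i ∈ s, sq i) := by
        intro s
        induction s using Finset.induction_on with
        | empty => simp
        | insert a s ha ih => rw [prod_insert ha, sum_insert ha, ih, AddChar.map_add_eq_mul]
      rw [h1]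
      have h2 : ∑ i, sq i = 0 := by
        have h3 := sum_sq_half hp
        have h4 : ∑ i : Fin n, ((((i : ℕ) + 1 : ℕ) : ZMod p) ^ 2) =
            ∑ j ∈ Icc 1 n, ((j : ZMod p) ^ 2) := by
          have := prod_fin_Icc (M := Multiplicative (ZMod p)) n
            (fun j => Multiplicative.ofAdd ((j : ZMod p) ^ 2))
          exact this
        rw [h4, ← h3]
        push_cast
        rfl
      rw [h2, AddChar.map_zero_eq_one]) (2 * Complex.I)
  have hdet : DC p 1 1 = (Matrix.of fun j k : Fin (n + 1) => (Fin.cases 1 (fun j' => 2 * Complex.I * (Fin.cons 1 w : Fin (n + 1) → ℂ) k / ((Fin.cons 1 w : Fin (n + 1) → ℂ) k - (w j')⁻¹)) j : ℂ)).det := by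
    unfold DC
    refine Matrix.det_eq_of_forall_row_eq_smul_add_const
      (fun j => if (j : ℕ) = 0 then 0 else - Complex.I) 0 (by simp) ?_
    intro j k
    refine Fin.cases ?_ (fun j' => ?_) j
    · simp
    · have hz : (Fin.cons 1 w : Fin (n + 1) → ℂ) k = ZMod.stdAddChar (((k : ℕ) : ZMod p) ^ 2) := by
        refine Fin.cases ?_ (fun k' => ?_) k
        · simp
        · simp [hw, hsq]
      have hu : (sq j' : ZMod p) + ((k : ℕ) : ZMod p) ^ 2 ≠ 0 := by
        intro h
        have h0 := eq_neg_of_add_eq_zero_right h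
        exact sq_ne_neg_sq hp4 (cast_ne_zero_of_mem_half (hmem j')) h0
      simp only [Matrix.of_apply, Fin.cases_succ, Fin.cases_zero, hz, Fin.val_succ]
      rw [if_neg (by omega), if_neg (by omega)]
      have hs : (1 : ZMod p) * (((j' : ℕ) + 1 : ℕ) : ZMod p) ^ 2 + 1 * ((k : ℕ) : ZMod p) ^ 2 =
        sq j' + ((k : ℕ) : ZMod p) ^ 2 := by rw [one_mul, one_mul]
      rw [hs]
      have h1 := hne1 _ hu
      unfold ctc
      rw [AddChar.map_add_eq_mul] at h1 ⊢
      change Complex.I * (w j' * _ + 1) / (w j' * _ - 1) = _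
      change w j' * _ ≠ 1 at h1
      have hw0 : w j' ≠ 0 := by
        intro h0
        have := norm_stdAddChar' (sq j')
        change ‖w j'‖ = 1 at this
        rw [h0] at this; simp at this
      generalize (ZMod.stdAddChar (((k : ℕ) : ZMod p) ^ 2) : ℂ) = z at *
      have h2 : w j' * z - 1 ≠ 0 := sub_ne_zero.2 h1
      have h3 : z - (w j')⁻¹ ≠ 0 := by
        intro h
        apply h2
        rw [sub_eq_zero.1 h]; field_simp; ring
      have h4 : z - (w j')⁻¹ = (w j' * z - 1) / w j' := by field_simp
      rw [h4]
      field_simp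
      ring
  rw [← hdet] at hbc
  -- pair products
  have hA : ∏ i : Fin n, ∏ j ∈ Ioi i, ((‖w i - (w j)⁻¹‖ : ℂ)) ^ 2 =
      ((∏ j ∈ Icc 1 n, ∏ k ∈ (Icc 1 n).erase j, gg ((j : ZMod p) ^ 2 + (k : ZMod p) ^ 2) : ℝ) : ℂ) := by
    rw [← prod_fin_Icc_erase n (fun j k => gg ((j : ZMod p) ^ 2 + (k : ZMod p) ^ 2)),
      offdiag_prod]
    push_cast
    refine prod_congr rfl fun i _ => prod_congr rfl fun j _ => ?_
    have h1 : ‖w i - (w j)⁻¹‖ = gg (sq i + sq j) := by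
      rw [← sub_neg_eq_add, ← norm_sub_stdAddChar (hsq_add i j), AddChar.map_neg_eq_inv]
    have h2 : ((((j : ℕ) : ZMod p) + 1) ^ 2 + (((i : ℕ) : ZMod p) + 1) ^ 2) = sq i + sq j := by
      simp [hsq]; ring
    have h3 : ((((i : ℕ) : ZMod p) + 1) ^ 2 + (((j : ℕ) : ZMod p) + 1) ^ 2) = sq i + sq j := by
      simp [hsq]
    rw [h1, h2, h3, pow_two]
  have hB : ∏ i : Fin n, ∏ j ∈ Ioi i, ((‖w i - w j‖ : ℂ)) ^ 2 =
      ((∏ j ∈ Icc 1 n, ∏ k ∈ (Icc 1 n).erase j, gg ((j : ZMod p) ^ 2 - (k : ZMod p) ^ 2) : ℝ) : ℂ) := by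
    rw [← prod_fin_Icc_erase n (fun j k => gg ((j : ZMod p) ^ 2 - (k : ZMod p) ^ 2)),
      offdiag_prod]
    push_cast
    refine prod_congr rfl fun i _ => prod_congr rfl fun j hj => ?_
    have hij : i ≠ j := (mem_Ioi.1 hj).ne
    have h1 : ‖w i - w j‖ = gg (sq i - sq j) := norm_sub_stdAddChar (hsq_inj.ne hij)
    have h2 : ((((j : ℕ) : ZMod p) + 1) ^ 2 - (((i : ℕ) : ZMod p) + 1) ^ 2) = - (sq i - sq j) := by
      simp [hsq]
    have h3 : ((((i : ℕ) : ZMod p) + 1) ^ 2 - (((j : ℕ) : ZMod p) + 1) ^ 2) = sq i - sq j := by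
      simp [hsq]
    rw [h1, h2, h3, gg_neg, pow_two]
  rw [hA, hB, prod_gg_key hp4] at hbc
  have hne : ((∏ j ∈ Icc 1 n, ∏ k ∈ (Icc 1 n).erase j, gg ((j : ZMod p) ^ 2 - (k : ZMod p) ^ 2) : ℝ) : ℂ) ≠ 0 := by
    rw [Complex.ofReal_ne_zero]
    exact (prod_pos fun j _ => prod_pos fun k _ => gg_pos _).ne'
  have h5 := mul_right_cancel₀ hne hbc
  have hR : ∏ i, (w i - (w i)⁻¹) = Complex.I ^ n * (((∏ k ∈ Icc 1 (p / 2), quadraticChar (ZMod p) (k : ZMod p) : ℤ) : ℂ)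
      * (Real.sqrt p : ℂ)) := by
    have hRR := R_eq hp4
    have h6 : ∀ i, w i - (w i)⁻¹ = Complex.I * ((2 * (ZMod.stdAddChar (sq i) : ℂ).im : ℝ) : ℂ) :=
      fun i => sub_inv_eq_im _
    rw [prod_congr rfl fun i _ => h6 i, prod_mul_distrib, prod_const, card_univ, Fintype.card_fin]
    congr 1
    have h7 := prod_fin_Icc n (fun j => 2 * (ZMod.stdAddChar ((j : ZMod p) ^ 2) : ℂ).im)
    rw [hRR] at h7
    rw [← Complex.ofReal_prod]
    have h8 := congrArg (fun r : ℝ => (r : ℂ)) h7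
    simp only [Complex.ofReal_mul, Complex.ofReal_intCast] at h8 
    rw [← h8]
  rw [hR, mul_pow, Odd.neg_one_pow (by rw [Nat.odd_iff]; omega)] at h5
  have hI : Complex.I ^ n ≠ 0 := pow_ne_zero _ Complex.I_ne_zero
  apply mul_right_cancel₀ hI
  linear_combination h5
end DC11

end PartP5

section PartP6
open Finset

section GaussSign
open Polynomial

/-- `A` vanishes to order `m` at `1` with leading coefficient `c`. -/
def LeadAt {F : Type*} [Field F] (A : F[X]) (m : ℕ) (c : F) : Prop :=
  ∃ B : F[X], A = (X - 1) ^ m * B ∧ B.eval 1 = c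

lemma LeadAt.mul {F : Type*} [Field F] {A B : F[X]} {m n : ℕ} {c d : F}
    (hA : LeadAt A m c) (hB : LeadAt B n d) : LeadAt (A * B) (m + n) (c * d) := by
  obtain ⟨A', rfl, rfl⟩ := hA
  obtain ⟨B', rfl, rfl⟩ := hB
  exact ⟨A' * B', by ring, by simp⟩

lemma LeadAt.prod {F ι : Type*} [Field F] (s : Finset ι) (A : ι → F[X]) (c : ι → F)
    (h : ∀ i ∈ s, LeadAt (A i) 1 (c i)) : LeadAt (∏ i ∈ s, A i) s.card (∏ i ∈ s, c i) := by
  classical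
  induction s using Finset.induction_on with
  | empty => exact ⟨1, by simp, by simp⟩
  | insert a s ha ih =>
    rw [prod_insert ha, prod_insert ha, card_insert_of_notMem ha, add_comm]
    exact (h a (mem_insert_self _ _)).mul (ih fun i hi => h i (mem_insert_of_mem hi))

lemma LeadAt.unique {F : Type*} [Field F] {A B : F[X]} {m : ℕ} {c d : F}
    (hA : LeadAt A m c) (hB : LeadAt B m d) (h : (X - 1) ^ (m + 1) ∣ A - B) : c = d := by
  obtain ⟨A', rfl, rfl⟩ := hA
  obtain ⟨B', rfl, rfl⟩ := hB
  obtain ⟨C, hC⟩ := h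
  have h1 : ((X : F[X]) - 1) ^ m ≠ 0 := pow_ne_zero _ (X_sub_C_ne_zero (1 : F))
  have h2 : A' - B' = (X - 1) * C := by
    apply mul_left_cancel₀ h1
    rw [mul_sub, hC]; ring
  have h3 := congrArg (Polynomial.eval 1) h2
  simp at h3
  exact sub_eq_zero.1 h3

lemma LeadAt.deriv {F : Type*} [Field F] {A : F[X]} {m : ℕ} {c : F}
    (hA : LeadAt A (m + 1) c) : LeadAt (X * derivative A) m ((m + 1 : ℕ) * c) := by
  obtain ⟨A', rfl, rfl⟩ := hA
  refine ⟨X * (((m + 1 : ℕ) : F[X]) * A' + (X - 1) * derivative A'), ?_, ?_⟩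
  · rw [derivative_mul, derivative_pow]
    simp only [derivative_sub, derivative_X, derivative_one, sub_zero, mul_one, Nat.add_sub_cancel, map_natCast]
    ring
  · simp

lemma LeadAt.C_mul {F : Type*} [Field F] {A : F[X]} {m : ℕ} {c : F}
    (hA : LeadAt A m c) (e : F) : LeadAt (C e * A) m (e * c) := by
  obtain ⟨A', rfl, rfl⟩ := hA
  exact ⟨C e * A', by ring, by simp⟩

variable {p : ℕ} [Fact p.Prime]

lemma lead_powsum (k : ℕ) (hk : k ≤ p - 1) :
    LeadAt (∑ j ∈ range p, C ((j : ZMod p) ^ k) * X ^ j) (p - 1 - k)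
      (∏ i ∈ range k, ((p - 1 - i : ℕ) : ZMod p)) := by
  induction k with
  | zero =>
    have h1 : cyclotomic (1 * p) (ZMod p) = cyclotomic 1 (ZMod p) ^ (p - 1) := 
      Polynomial.cyclotomic_mul_prime_eq_pow_of_not_dvd (ZMod p)
        (by intro h; have := Nat.le_of_dvd (by omega) h; have := (Fact.out : p.Prime).two_le; omega)
    rw [one_mul, cyclotomic_prime, cyclotomic_one] at h1
    refine ⟨1, ?_, by simp⟩
    simp [h1]
  | succ k ih =>
    have h2 := ih (by omega)
    rw [show p - 1 - k = (p - 1 - (k + 1)) + 1 by omega] at h2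
    have h3 := h2.deriv
    rw [prod_range_succ, mul_comm]
    convert h3 using 1
    · rw [derivative_sum, mul_sum]
      refine sum_congr rfl fun j hj => ?_
      rw [derivative_C_mul, derivative_X_pow]
      rcases j with _ | j
      · simp
      · simp only [Nat.add_sub_cancel, pow_succ, C_mul]
        simp
        ring
    · congr 2
      omega

lemma lead_diff {k : ℕ} (hk : k ≤ p) :
    LeadAt ((X : (ZMod p)[X]) ^ k - X ^ (p - k)) 1 (2 * (k : ZMod p)) := by
  have h : ∀ m : ℕ, ∃ B : (ZMod p)[X], X ^ m - 1 = (X - 1) * B ∧ B.eval 1 = m := by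
    intro m
    refine ⟨∑ i ∈ range m, X ^ i, ?_, by simp [eval_finset_sum]⟩
    rw [mul_comm, geom_sum_mul]
  obtain ⟨B, hB, hB1⟩ := h k
  obtain ⟨B', hB', hB1'⟩ := h (p - k)
  refine ⟨B - B', ?_, ?_⟩
  · linear_combination hB - hB'
  · rw [eval_sub, hB1, hB1', Nat.cast_sub hk]
    simp; ring

lemma two_pow_half_ne (hp4 : p % 4 = 3) : (2 : ZMod p) ≠ 0 := by
  intro h
  have : ((2 : ℕ) : ZMod p) = 0 := by exact_mod_cast h
  rw [ZMod.natCast_eq_zero_iff] at this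
  have := Nat.le_of_dvd (by omega) this
  have := (Fact.out : p.Prime).two_le
  omega

/-- Sign of the quadratic Gauss sum. -/
lemma gauss_sign (hp4 : p % 4 = 3) :
    ∑ j : ZMod p, ((quadraticChar (ZMod p) j : ℤ) : ℂ) * ZMod.stdAddChar j =
      Complex.I * (Real.sqrt p : ℂ) := by
  have hpp := (Fact.out : p.Prime)
  set n := p / 2 with hn
  set G := ∑ j : ZMod p, ((quadraticChar (ZMod p) j : ℤ) : ℂ) * ZMod.stdAddChar j with hG
  set ζ : ℂ := ZMod.stdAddChar (1 : ZMod p) with hζ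
  have hpow : ∀ k : ℕ, (ZMod.stdAddChar (k : ZMod p) : ℂ) = ζ ^ k := by
    intro k
    rw [hζ, ← AddChar.map_nsmul_eq_pow, nsmul_eq_mul, mul_one]
  set Q := ∏ k ∈ Icc 1 n, ((ZMod.stdAddChar (k : ZMod p) : ℂ) - (ZMod.stdAddChar (k : ZMod p))⁻¹) with hQ
  have hQ1 : Q = Complex.I ^ n * (Real.sqrt p : ℂ) := by
    rw [hQ, prod_congr rfl fun k _ => sub_inv_eq_im _, prod_mul_distrib, prod_const,
      Nat.card_Icc, ← (R_T_eq hp4).2]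
    push_cast
    simp [hn]
  have hsqrt : ((Real.sqrt p : ℝ) : ℂ) ^ 2 = p := by
    rw [← Complex.ofReal_pow, Real.sq_sqrt (by positivity)]; simp
  have hQ2 : Q ^ 2 = - p := by
    rw [hQ1, mul_pow, hsqrt, ← pow_mul, mul_comm n, pow_mul, Complex.I_sq,
      Odd.neg_one_pow (by rw [Nat.odd_iff]; omega)]
    ring
  have hG2 : G ^ 2 = - p := by
    have hF : ringChar (ZMod p) ≠ 2 := by rw [ZMod.ringChar_zmod_n]; omega
    have hχ : ((quadraticChar (ZMod p)).ringHomComp (Int.castRingHom ℂ)) ≠ 1 := by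
      rw [MulChar.ringHomComp_ne_one_iff (RingHom.injective_int _)]
      exact quadraticChar_ne_one hF
    have := gaussSum_sq hχ ((quadraticChar_isQuadratic (ZMod p)).comp _) (ZMod.isPrimitive_stdAddChar p)
    rw [ZMod.card] at this
    have h1 : ((quadraticChar (ZMod p)).ringHomComp (Int.castRingHom ℂ)) (-1) = -1 := by
      rw [MulChar.ringHomComp_apply, quadraticChar_neg_one hF, ZMod.card,
        ZMod.χ₄_nat_three_mod_four hp4]
      simp
    rw [h1] at this
    rw [hG]
    simp only [gaussSum, MulChar.ringHomComp_apply] at this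
    rw [neg_one_mul] at this
    exact this
  have hGQ : ∃ ε : ℤ, G = ε * Q ∧ (ε = 1 ∨ ε = -1) := by
    rcases sq_eq_sq_iff_eq_or_eq_neg.1 (hG2.trans hQ2.symm) with h | h
    · exact ⟨1, by simp [h], Or.inl rfl⟩
    · exact ⟨-1, by simp [h], Or.inr rfl⟩
  obtain ⟨ε, hε, hε1⟩ := hGQ
  -- polynomials
  let A : ℤ[X] := ∑ j ∈ range p, C (quadraticChar (ZMod p) (j : ZMod p)) * X ^ j
  let B : ℤ[X] := ∏ k ∈ Icc 1 n, (X ^ k - X ^ (p - k))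
  have hA : aeval ζ A = G := by
    simp only [A, map_sum, map_mul, aeval_C, map_pow, aeval_X]
    rw [hG]
    refine Finset.sum_bij' (fun j _ => (j : ZMod p)) (fun j _ => j.val) ?_ ?_ ?_ ?_ ?_
    · simp
    · intro a _; simpa using ZMod.val_lt a
    · intro a ha; exact ZMod.val_cast_of_lt (mem_range.1 ha)
    · intro a _; simp
    · intro a _; rw [hpow]; simp
  have hB : aeval ζ B = Q := by
    simp only [B, map_prod, map_sub, map_pow, aeval_X]
    rw [hQ]
    refine prod_congr rfl fun k hk => ?_
    rw [← AddChar.map_neg_eq_inv, hpow, ← hpow (p - k), Nat.cast_sub (by rw [mem_Icc] at hk; omega)]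
    simp
  have hζp : IsPrimitiveRoot ζ p := by
    have := Complex.isPrimitiveRoot_exp p hpp.ne_zero
    convert this using 1
    have h1 := ZMod.stdAddChar_coe (N := p) 1
    simp only [Int.cast_one] at h1
    rw [hζ, h1]; simp
  have hdvd : cyclotomic p ℤ ∣ A - C ε * B := by
    rw [cyclotomic_eq_minpoly hζp hpp.pos]
    apply minpoly.isIntegrallyClosed_dvd (hζp.isIntegral hpp.pos)
    simp only [map_sub, map_mul, aeval_C, hA, hB, hε]
    simp
  have hdvd2 := Polynomial.map_dvd (Int.castRingHom (ZMod p)) hdvd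
  rw [map_cyclotomic] at hdvd2
  have hcyc : cyclotomic p (ZMod p) = (X - 1) ^ (p - 1) := by
    have h1 : cyclotomic (1 * p) (ZMod p) = cyclotomic 1 (ZMod p) ^ (p - 1) := 
      Polynomial.cyclotomic_mul_prime_eq_pow_of_not_dvd (ZMod p)
        (by intro h; have := Nat.le_of_dvd (by omega) h; have := hpp.two_le; omega)
    rwa [one_mul, cyclotomic_one] at h1
  rw [hcyc, Polynomial.map_sub, Polynomial.map_mul, Polynomial.map_C] at hdvd2
  have hF : ringChar (ZMod p) ≠ 2 := by rw [ZMod.ringChar_zmod_n]; omega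
  have hchi : ∀ u : ZMod p, ((quadraticChar (ZMod p) u : ℤ) : ZMod p) = u ^ n := by
    intro u
    have := quadraticChar_eq_pow_of_char_ne_two' hF u
    rwa [ZMod.card] at this
  have hAl : LeadAt (A.map (Int.castRingHom (ZMod p))) n (∏ i ∈ range n, ((p - 1 - i : ℕ) : ZMod p)) := by
    have := lead_powsum (p := p) n (by omega)
    rw [show p - 1 - n = n by omega] at this
    convert this using 1
    simp only [A, Polynomial.map_sum, Polynomial.map_mul, Polynomial.map_C, Polynomial.map_pow, Polynomial.map_X]
    refine sum_congr rfl fun j _ => ?_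
    rw [← hchi]; rfl
  have hBl : LeadAt (B.map (Int.castRingHom (ZMod p))) n (∏ k ∈ Icc 1 n, (2 * (k : ZMod p))) := by
    have := LeadAt.prod (Icc 1 n) (fun k => (X : (ZMod p)[X]) ^ k - X ^ (p - k)) (fun k => 2 * (k : ZMod p))
      (fun k hk => lead_diff (by rw [mem_Icc] at hk; omega))
    rw [Nat.card_Icc, Nat.add_sub_cancel] at this
    convert this using 1
    simp only [B, Polynomial.map_prod, Polynomial.map_sub, Polynomial.map_pow, Polynomial.map_X]
  have hc := hAl.unique (hBl.C_mul (Int.castRingHom (ZMod p) ε))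
    (dvd_trans (pow_dvd_pow _ (by omega)) hdvd2)
  have hprod : ∏ i ∈ range n, ((p - 1 - i : ℕ) : ZMod p) = - ∏ k ∈ Icc 1 n, (k : ZMod p) := by
    have h1 : ∀ i ∈ range n, ((p - 1 - i : ℕ) : ZMod p) = - ((i + 1 : ℕ) : ZMod p) := by
      intro i hi
      rw [mem_range] at hi
      rw [show p - 1 - i = p - (i + 1) by omega, Nat.cast_sub (by omega)]
      simp
    rw [prod_congr rfl h1, prod_neg, card_range, Odd.neg_one_pow (by rw [Nat.odd_iff]; omega),
      neg_one_mul, ← prod_fin_Icc n (fun k => (k : ZMod p)), ← Fin.prod_univ_eq_prod_range (fun i => ((i + 1 : ℕ) : ZMod p))]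
  rw [hprod, prod_mul_distrib, prod_const, Nat.card_Icc, Nat.add_sub_cancel, ← hchi 2] at hc
  have hne : ∏ k ∈ Icc 1 n, (k : ZMod p) ≠ 0 :=
    prod_ne_zero_iff.2 fun k hk => cast_ne_zero_of_mem_half hk
  have hc2 : ((ε * quadraticChar (ZMod p) 2 : ℤ) : ZMod p) = ((-1 : ℤ) : ZMod p) := by
    apply mul_right_cancel₀ hne
    push_cast
    rw [neg_one_mul, hc, mul_assoc]
    rfl
  have h2 := quadraticChar_two hF
  rw [ZMod.card] at h2
  have hne2 : ((1 : ℤ) : ZMod p) ≠ ((-1 : ℤ) : ZMod p) := by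
    intro h
    apply two_pow_half_ne hp4
    push_cast at h
    linear_combination h
  have hp8 : p % 8 = 3 ∨ p % 8 = 7 := by omega
  rw [hε, hQ1]
  rcases hp8 with h8 | h8
  · have h3 : quadraticChar (ZMod p) 2 = -1 := by
      rw [h2, ZMod.χ₈_nat_eq_if_mod_eight]
      rw [if_neg (by omega), if_neg (by omega)]
    have h4 : ε = 1 := by
      rcases hε1 with h | h
      · exact h
      · rw [h, h3] at hc2; exact absurd hc2 hne2
    rw [h4, show n = 4 * (p / 8) + 1 by omega, pow_succ, pow_mul, Complex.I_pow_four]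
    simp
  · have h3 : quadraticChar (ZMod p) 2 = 1 := by
      rw [h2, ZMod.χ₈_nat_eq_if_mod_eight]
      rw [if_neg (by omega), if_pos (by omega)]
    have h4 : ε = -1 := by
      rcases hε1 with h | h
      · rw [h, h3] at hc2; exact absurd hc2 hne2
      · exact h
    rw [h4, show n = 4 * (p / 8) + 3 by omega, pow_add, pow_mul, Complex.I_pow_four, pow_succ, Complex.I_sq]
    simp
end GaussSign

end PartP6


section QuadField
open NumberField

/-- The concrete model `ℤ[ω]`, `ω² = ω - m`, of the maximal order. -/
abbrev OrdA (m : ℕ) := QuadraticAlgebra ℤ (-(m : ℤ)) 1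

variable {p : ℕ} {K : Type*} [Field K] [NumberField K] {θ : K}

lemma exists_rat_rep (hθ : θ ^ 2 = -(p : K))
    (hgen : ∀ y : K, y ∈ Algebra.adjoin ℚ ({θ} : Set K)) (x : K) :
    ∃ r s : ℚ, x = (r : K) + (s : K) * θ := by
  have hx := hgen x
  induction hx using Algebra.adjoin_induction with
  | mem x hx => exact ⟨0, 1, by rw [Set.mem_singleton_iff.1 hx]; simp⟩
  | algebraMap r => exact ⟨r, 0, by simp⟩
  | add x y _ _ hx hy =>
    obtain ⟨a, b, rfl⟩ := hx
    obtain ⟨c, d, rfl⟩ := hy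
    exact ⟨a + c, b + d, by push_cast; ring⟩
  | mul x y _ _ hx hy =>
    obtain ⟨a, b, rfl⟩ := hx
    obtain ⟨c, d, rfl⟩ := hy
    refine ⟨a * c - p * b * d, a * d + b * c, ?_⟩
    push_cast
    linear_combination (b : K) * d * hθ

lemma emb_theta (hp : 0 < p) (hθ : θ ^ 2 = -(p : K)) (φ : K →+* ℂ) :
    (φ θ).re = 0 ∧ (φ θ).im ^ 2 = p := by
  have h : (φ θ) ^ 2 = -(p : ℂ) := by rw [← map_pow, hθ]; simp
  rw [sq, Complex.ext_iff] at h
  simp at h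
  obtain ⟨h1, h2⟩ := h
  have hpos : (0 : ℝ) < p := by exact_mod_cast hp
  have h3 : (φ θ).re * (φ θ).im = 0 := by linarith
  rcases mul_eq_zero.1 h3 with h4 | h4
  · refine ⟨h4, ?_⟩
    rw [h4] at h1; linarith
  · exfalso
    rw [h4] at h1
    nlinarith [sq_nonneg (φ θ).re]

lemma theta_indep (hp : 0 < p) (hθ : θ ^ 2 = -(p : K)) {r s : ℚ}
    (h : (r : K) + (s : K) * θ = 0) : r = 0 ∧ s = 0 := by
  obtain ⟨φ⟩ : Nonempty (K →+* ℂ) := inferInstance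
  obtain ⟨h1, h2⟩ := emb_theta hp hθ φ
  have h3 := congrArg φ h
  simp only [map_add, map_mul, map_ratCast, map_zero] at h3
  rw [Complex.ext_iff] at h3
  simp [h1] at h3
  have hpos : (0 : ℝ) < p := by exact_mod_cast hp
  refine ⟨h3.1, ?_⟩
  rcases h3.2 with h | h
  · exact h
  · rw [h] at h2; simp at h2; exact absurd h2.symm hpos.ne'

lemma rat_int_of_isIntegral {q : ℚ} (h : IsIntegral ℤ (q : ℂ)) : ∃ a : ℤ, q = a := by
  have h1 : IsIntegral ℤ q := by
    have := (isIntegral_algebraMap_iff (R := ℤ) (A := ℚ) (B := ℂ) (x := q)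
      (algebraMap ℚ ℂ).injective).1 (by simpa using h)
    exact this
  obtain ⟨a, ha⟩ := IsIntegrallyClosed.isIntegral_iff.1 h1
  exact ⟨a, by rw [← ha]; simp⟩

lemma integral_rep (hpp : p.Prime) (hp4 : p % 4 = 3) (hθ : θ ^ 2 = -(p : K))
    (hgen : ∀ y : K, y ∈ Algebra.adjoin ℚ ({θ} : Set K)) {x : K} (hx : IsIntegral ℤ x) :
    ∃ u v : ℤ, x = (u : K) + (v : K) * ((1 + θ) / 2) := by
  obtain ⟨r, s, rfl⟩ := exists_rat_rep hθ hgen x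
  obtain ⟨φ⟩ : Nonempty (K →+* ℂ) := inferInstance
  obtain ⟨h1, h2⟩ := emb_theta hpp.pos hθ φ
  set y := φ ((r : K) + s * θ) with hy
  have hIntg : IsIntegral ℤ y := hx.map φ.toIntAlgHom
  have hIntg2 : IsIntegral ℤ (starRingEnd ℂ y) := hIntg.map (starRingEnd ℂ).toIntAlgHom
  have hyv : y = r + s * φ θ := by simp [hy]
  have hφ : starRingEnd ℂ (φ θ) = - φ θ := by
    apply Complex.ext <;> simp [h1]
  have hyc : starRingEnd ℂ y = r - s * φ θ := by
    rw [hyv, map_add, map_mul, hφ, map_ratCast, map_ratCast]; ring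
  have hφ2 : φ θ ^ 2 = -(p : ℂ) := by rw [← map_pow, hθ]; simp
  obtain ⟨a, ha⟩ : ∃ a : ℤ, 2 * r = a := by
    apply rat_int_of_isIntegral
    have : ((2 * r : ℚ) : ℂ) = y + starRingEnd ℂ y := by rw [hyc, hyv]; push_cast; ring
    rw [this]; exact hIntg.add hIntg2
  obtain ⟨c, hc⟩ : ∃ c : ℤ, r ^ 2 + p * s ^ 2 = c := by
    apply rat_int_of_isIntegral
    have : ((r ^ 2 + p * s ^ 2 : ℚ) : ℂ) = y * starRingEnd ℂ y := by
      rw [hyc, hyv]; push_cast; linear_combination (s : ℂ) ^ 2 * hφ2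
    rw [this]; exact hIntg.mul hIntg2
  -- t is an integer
  have ht : (p : ℚ) * (2 * s) ^ 2 = ((4 * c - a ^ 2 : ℤ) : ℚ) := by
    push_cast; rw [← hc, ← ha]; ring
  obtain ⟨t, htt⟩ : ∃ t : ℤ, 2 * s = t := by
    -- `p * t` is an integer, with square divisible by `p`
    have h5 : IsIntegral ℤ ((p : ℚ) * (2 * s)) := by
      refine ⟨Polynomial.X ^ 2 - Polynomial.C ((p : ℤ) * (4 * c - a ^ 2)), Polynomial.monic_X_pow_sub_C _ (by norm_num), ?_⟩
      simp only [Polynomial.eval₂_sub, Polynomial.eval₂_pow, Polynomial.eval₂_X, Polynomial.eval₂_C]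
      rw [sub_eq_zero, mul_pow, sq (p : ℚ), mul_assoc, ht]
      simp
    obtain ⟨d, hd⟩ := IsIntegrallyClosed.isIntegral_iff.1 h5
    have hd' : (d : ℚ) = p * (2 * s) := by rw [← hd]; simp
    have h6 : d ^ 2 = p * (4 * c - a ^ 2) := by
      have : ((d ^ 2 : ℤ) : ℚ) = ((p * (4 * c - a ^ 2) : ℤ) : ℚ) := by
        rw [Int.cast_mul, ← ht]; push_cast; rw [hd']; ring
      exact_mod_cast this
    have h7 : (p : ℤ) ∣ d := (Nat.prime_iff_prime_int.1 hpp).dvd_of_dvd_pow ⟨_, h6⟩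
    obtain ⟨t, rfl⟩ := h7
    refine ⟨t, ?_⟩
    have hp0 : (p : ℚ) ≠ 0 := by exact_mod_cast hpp.ne_zero
    apply mul_left_cancel₀ hp0
    rw [← hd']; push_cast; ring
  have h8 : (p : ℤ) * t ^ 2 = 4 * c - a ^ 2 := by
    have := ht
    rw [htt] at this
    exact_mod_cast this
  have h9 : (a - t) % 2 = 0 := by
    obtain ⟨k, hk⟩ : ∃ k : ℤ, (p : ℤ) = 4 * k + 3 := ⟨p / 4, by omega⟩
    rw [hk] at h8
    rcases Int.even_or_odd' a with ⟨α, h | h⟩ <;> rcases Int.even_or_odd' t with ⟨β, h' | h'⟩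
    · omega
    · exfalso; rw [h, h'] at h8; ring_nf at h8; omega
    · exfalso; rw [h, h'] at h8; ring_nf at h8; omega
    · omega
  obtain ⟨u, hu⟩ := Int.dvd_of_emod_eq_zero h9
  refine ⟨u, t, ?_⟩
  have hu' : (2 : K) * u = 2 * r - 2 * s := by
    have h10 : (2 : ℚ) * u = 2 * r - 2 * s := by
      rw [ha, htt]; exact_mod_cast hu.symm
    exact_mod_cast congrArg (fun q : ℚ => (q : K)) h10
  have hs' : (2 : K) * s = t := by exact_mod_cast congrArg (fun q : ℚ => (q : K)) htt
  have h20 : (2 : K) ≠ 0 := two_ne_zero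
  apply mul_left_cancel₀ h20
  field_simp
  linear_combination (-1 : K) * hu' + (θ + 1) * hs'

lemma exists_equiv (hpp : p.Prime) (hp4 : p % 4 = 3) (hθ : θ ^ 2 = -(p : K))
    (hgen : ∀ y : K, y ∈ Algebra.adjoin ℚ ({θ} : Set K)) :
    Nonempty (OrdA ((p + 1) / 4) ≃ₐ[ℤ] 𝓞 K) := by
  obtain ⟨m, hm⟩ : ∃ m, p + 1 = 4 * m := ⟨(p + 1) / 4, by omega⟩
  have hm' : (p + 1) / 4 = m := by omega
  rw [hm']
  have hpm : (p : K) = 4 * m - 1 := by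
    have : ((p + 1 : ℕ) : K) = ((4 * m : ℕ) : K) := by rw [hm]
    push_cast at this
    linear_combination this
  have hw : ((1 + θ) / 2) ^ 2 = (1 + θ) / 2 - m := by
    field_simp
    linear_combination hθ - hpm
  have hIntg : IsIntegral ℤ ((1 + θ) / 2) := by
    refine ⟨Polynomial.X ^ 2 + (- Polynomial.X + Polynomial.C (m : ℤ)), ?_, ?_⟩
    · apply Polynomial.monic_X_pow_add
      refine lt_of_le_of_lt (Polynomial.degree_add_le _ _) ?_
      rw [Polynomial.degree_neg, Polynomial.degree_X]
      refine max_lt (by norm_num) (lt_of_le_of_lt Polynomial.degree_C_le (by norm_num))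
    · simp only [Polynomial.eval₂_add, Polynomial.eval₂_neg, Polynomial.eval₂_pow, Polynomial.eval₂_X, Polynomial.eval₂_C, hw]
      simp
  obtain ⟨w, hwv⟩ : ∃ w : 𝓞 K, algebraMap (𝓞 K) K w = (1 + θ) / 2 := ⟨⟨(1 + θ) / 2, hIntg⟩, rfl⟩
  have hinj : Function.Injective (algebraMap (𝓞 K) K) := FaithfulSMul.algebraMap_injective (𝓞 K) K
  have hww : w * w = (-(m : ℤ)) • (1 : 𝓞 K) + (1 : ℤ) • w := by
    apply hinj
    simp only [map_mul, map_add, zsmul_eq_mul, hwv, map_intCast, map_one]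
    push_cast
    linear_combination hw
  let f := QuadraticAlgebra.lift (⟨w, hww⟩ : { u : 𝓞 K // u * u = (-(m : ℤ)) • 1 + (1 : ℤ) • u })
  have hf : ∀ z, algebraMap (𝓞 K) K (f z) = (z.re : K) + (z.im : K) * ((1 + θ) / 2) := by
    intro z
    simp [f, hwv, -zsmul_eq_mul, map_zsmul]
    simp
  refine ⟨AlgEquiv.ofBijective f ⟨?_, ?_⟩⟩
  · rw [injective_iff_map_eq_zero]
    intro z hz
    have h1 := hf z
    rw [hz] at h1
    have h2 : (((z.re : ℚ) + z.im / 2 : ℚ) : K) + ((z.im / 2 : ℚ) : K) * θ = 0 := by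
      push_cast
      rw [map_zero] at h1
      linear_combination -h1
    have h3 := theta_indep hpp.pos hθ h2
    have h4 : z.im = 0 := by
      have : (z.im : ℚ) = 0 := by linarith [h3.2]
      exact_mod_cast this
    have h5 : z.re = 0 := by
      have h6 := h3.1
      rw [h4] at h6
      have : (z.re : ℚ) = 0 := by simpa using h6
      exact_mod_cast this
    ext <;> simp [h4, h5]
  · intro y
    obtain ⟨u, v, h⟩ := integral_rep hpp hp4 hθ hgen y.isIntegral_coe
    refine ⟨⟨u, v⟩, ?_⟩
    apply hinj
    rw [hf, h]

end QuadField


section QuadFieldInv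
open NumberField NumberField.InfinitePlace NumberField.Units

variable {p : ℕ} {K : Type*} [Field K] [NumberField K] {θ : K}

lemma discr_of_equiv {m : ℕ} (E : OrdA m ≃ₐ[ℤ] 𝓞 K) : discr K = 1 - 4 * m := by
  rw [← NumberField.discr_eq_discr K ((QuadraticAlgebra.basis (-(m : ℤ)) 1).map E.toLinearEquiv)]
  have h1 : (⇑((QuadraticAlgebra.basis (-(m : ℤ)) 1).map E.toLinearEquiv) : Fin 2 → 𝓞 K) =
      E ∘ (QuadraticAlgebra.basis (-(m : ℤ)) (1 : ℤ)) := by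
    ext i; simp
  rw [h1, ← Algebra.discr_eq_discr_of_algEquiv, Algebra.discr_def, Matrix.det_fin_two]
  have htr : ∀ z : OrdA m, Algebra.trace ℤ (OrdA m) z = 2 * z.re + z.im := by
    intro z
    rw [Algebra.trace_eq_matrix_trace (QuadraticAlgebra.basis (-(m : ℤ)) 1), Matrix.trace_fin_two]
    simp only [Algebra.leftMulMatrix_eq_repr_mul, QuadraticAlgebra.basis_repr_apply]
    simp [QuadraticAlgebra.basis]
    ring
  simp only [Algebra.traceMatrix_apply, Algebra.traceForm_apply, htr]
  simp [QuadraticAlgebra.basis]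
  ring

lemma finrank_of_equiv {m : ℕ} (E : OrdA m ≃ₐ[ℤ] 𝓞 K) : Module.finrank ℤ (𝓞 K) = 2 := by
  rw [← E.toLinearEquiv.finrank_eq]
  exact QuadraticAlgebra.finrank_eq_two _ _

lemma units_of_equiv {m : ℕ} (hm : 2 ≤ m) (E : OrdA m ≃ₐ[ℤ] 𝓞 K) (u : (𝓞 K)ˣ) :
    u = 1 ∨ u = -1 := by
  have hE : IsUnit (E.symm (u : 𝓞 K)) := u.isUnit.map E.symm
  set z := E.symm (u : 𝓞 K) with hz
  have hu : (u : 𝓞 K) = E z := by simp [hz]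
  have h1 : IsUnit (QuadraticAlgebra.norm z) := hE.map _
  rw [QuadraticAlgebra.norm_def, Int.isUnit_iff] at h1
  have hm' : (2 : ℤ) ≤ m := by exact_mod_cast hm
  have h2 : z.im = 0 := by
    by_contra h
    have h3 : 1 ≤ z.im ^ 2 := by
      have := sq_nonneg z.im
      have h4 : z.im ^ 2 ≠ 0 := pow_ne_zero 2 h
      omega
    rcases h1 with h1 | h1 <;> nlinarith [sq_nonneg (2 * z.re + z.im)]
  rw [h2] at h1
  have h3 : z.re ^ 2 = 1 := by
    rcases h1 with h1 | h1
    · linarith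
    · nlinarith [sq_nonneg z.re]
  have h4 : z.re = 1 ∨ z.re = -1 := by
    have h5 : (z.re - 1) * (z.re + 1) = 0 := by linear_combination h3
    rcases mul_eq_zero.1 h5 with h | h <;> omega
  rcases h4 with h | h
  · left
    apply Units.ext
    have h5 : z = 1 := by
      apply QuadraticAlgebra.ext
      · rw [h]; rfl
      · rw [h2]; rfl
    rw [hu, h5, map_one, Units.val_one]
  · right
    apply Units.ext
    have h5 : z = -1 := by
      apply QuadraticAlgebra.ext
      · rw [h]; rfl
      · rw [h2]; rfl
    rw [hu, h5, map_neg, map_one, Units.val_neg, Units.val_one]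

lemma torsionOrder_of_equiv {m : ℕ} (hm : 2 ≤ m) (E : OrdA m ≃ₐ[ℤ] 𝓞 K) : torsionOrder K = 2 := by
  classical
  have h1 : torsionOrder K ≤ 2 := by
    rw [torsionOrder]
    have hinj : Function.Injective (fun t : torsion K => (decide ((t : (𝓞 K)ˣ) = 1) : Bool)) := by
      intro s t h
      simp only [decide_eq_decide] at h
      apply Subtype.ext
      rcases units_of_equiv hm E s with hs | hs <;> rcases units_of_equiv hm E t with ht | ht
      · rw [hs, ht]
      · rw [h.1 hs, hs]
      · rw [h.2 ht, ht]
      · rw [hs, ht]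
    simpa using Nat.card_le_card_of_injective _ hinj
  have h2 := even_torsionOrder K
  have h3 := torsionOrder_pos K
  obtain ⟨k, hk⟩ := h2
  omega

lemma nrReal_zero (hp : 0 < p) (hθ : θ ^ 2 = -(p : K)) : nrRealPlaces K = 0 := by
  rw [nrRealPlaces_eq_zero_iff]
  refine ⟨fun v => ?_⟩
  by_contra hv
  rw [not_isComplex_iff_isReal, InfinitePlace.isReal_iff] at hv
  obtain ⟨h1, h2⟩ := emb_theta hp hθ v.embedding
  have h3 : (v.embedding θ).im = 0 := by
    have := ComplexEmbedding.IsReal.coe_embedding_apply hv θ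
    rw [← this]; exact Complex.ofReal_im _
  rw [h3] at h2
  have : (0 : ℝ) < p := by exact_mod_cast hp
  simp at h2
  linarith

lemma nrComplex_one {m : ℕ} (hp : 0 < p) (hθ : θ ^ 2 = -(p : K)) (E : OrdA m ≃ₐ[ℤ] 𝓞 K) :
    nrComplexPlaces K = 1 := by
  have h := card_add_two_mul_card_eq_rank K
  rw [nrReal_zero hp hθ, ← RingOfIntegers.rank, finrank_of_equiv E] at h
  omega

lemma regulator_one {m : ℕ} (hp : 0 < p) (hθ : θ ^ 2 = -(p : K)) (E : OrdA m ≃ₐ[ℤ] 𝓞 K) :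
    regulator K = 1 := by
  have hc : Fintype.card (InfinitePlace K) = 1 := by
    rw [card_eq_nrRealPlaces_add_nrComplexPlaces, nrReal_zero hp hθ, nrComplex_one hp hθ E]
  have hr : rank K = 0 := by rw [rank, hc]
  rw [regulator_eq_det']
  have : IsEmpty {w : InfinitePlace K // w ≠ dirichletUnitTheorem.w₀} := by
    rw [← Equiv.isEmpty_congr (equivFinRank K), hr]
    infer_instance
  classical
  rw [Matrix.det_eq_one_of_card_eq_zero (Fintype.card_eq_zero_iff.2 this), abs_one]

lemma residue_eq (hpp : p.Prime) (hp3 : 3 < p) (hp4 : p % 4 = 3) (hθ : θ ^ 2 = -(p : K))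
    (hgen : ∀ y : K, y ∈ Algebra.adjoin ℚ ({θ} : Set K)) :
    dedekindZeta_residue K = Real.pi * classNumber K / Real.sqrt p := by
  obtain ⟨E⟩ := exists_equiv hpp hp4 hθ hgen
  rw [dedekindZeta_residue_def, nrReal_zero hpp.pos hθ, nrComplex_one hpp.pos hθ E,
    regulator_one hpp.pos hθ E, torsionOrder_of_equiv (by omega) E, discr_of_equiv E]
  have : |((1 - 4 * ((p + 1) / 4 : ℕ) : ℤ) : ℝ)| = p := by
    have h1 : (1 - 4 * ((p + 1) / 4 : ℕ) : ℤ) = - (p : ℤ) := by omega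
    rw [h1]; simp
  have h2 : ((1 - 4 * ((p + 1) / 4 : ℕ) : ℤ) : ℝ) = - p := by
    have h1 : (1 - 4 * ((p + 1) / 4 : ℕ) : ℤ) = - (p : ℤ) := by omega
    rw [h1]; simp
  rw [h2, abs_neg, Nat.abs_cast]
  field_simp
  ring

end QuadFieldInv


section IdealCount
open NumberField Ideal

variable {K : Type*} [Field K] [NumberField K]

variable (K) in
/-- number of ideals of norm `n` -/
noncomputable def rr (n : ℕ) : ℕ := Nat.card {I : Ideal (𝓞 K) // absNorm I = n}

lemma rr_one : rr K 1 = 1 := by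
  rw [rr, Nat.card_eq_one_iff_unique]
  refine ⟨⟨fun a b => Subtype.ext ?_⟩, ⟨⟨⊤, absNorm_top⟩⟩⟩
  rw [absNorm_eq_one_iff.1 a.2, absNorm_eq_one_iff.1 b.2]

lemma natCast_mem_of_norm {I : Ideal (𝓞 K)} {n : ℕ} (h : absNorm I = n) : (n : 𝓞 K) ∈ I := by
  rw [← h]; exact absNorm_mem I

lemma coprime_sup {I J : Ideal (𝓞 K)} {m n : ℕ} (hmn : m.Coprime n) (hm : (m : 𝓞 K) ∈ I)
    (hn : (n : 𝓞 K) ∈ J) : I ⊔ J = ⊤ := by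
  rw [eq_top_iff_one]
  have h := Nat.gcd_eq_gcd_ab m n
  rw [hmn] at h
  have h' : (1 : 𝓞 K) = m * (m.gcdA n : ℤ) + n * (m.gcdB n : ℤ) := by exact_mod_cast congrArg (fun z : ℤ => (z : 𝓞 K)) h
  rw [h']
  exact add_mem (mem_sup_left (I.mul_mem_right _ hm)) (mem_sup_right (J.mul_mem_right _ hn))

lemma recover {I J : Ideal (𝓞 K)} {m n : ℕ} (hmn : m.Coprime n) (hm : absNorm I = m)
    (hn : absNorm J = n) : I * J ⊔ span {(m : 𝓞 K)} = I := by
  have hmI := natCast_mem_of_norm hm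
  have hnJ := natCast_mem_of_norm hn
  apply le_antisymm
  · exact sup_le mul_le_left ((span_singleton_le_iff_mem I).2 hmI)
  · have h : J ⊔ span {(m : 𝓞 K)} = ⊤ :=
      coprime_sup hmn.symm hnJ (mem_span_singleton_self _)
    calc I = I * (J ⊔ span {(m : 𝓞 K)}) := by rw [h, mul_top]
      _ = I * J ⊔ I * span {(m : 𝓞 K)} := by rw [Ideal.mul_sup]
      _ ≤ _ := sup_le_sup_left mul_le_right _

lemma rr_mul {m n : ℕ} (hmn : m.Coprime n) (h0 : m * n ≠ 0) : rr K (m * n) = rr K m * rr K n := by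
  rw [rr, rr, rr, ← Nat.card_prod]
  symm
  refine Nat.card_congr (Equiv.ofBijective
    (fun x => ⟨x.1.1 * x.2.1, by rw [map_mul, x.1.2, x.2.2]⟩) ⟨?_, ?_⟩)
  · rintro ⟨⟨a, ha⟩, ⟨b, hb⟩⟩ ⟨⟨c, hc⟩, ⟨d, hd⟩⟩ h
    simp only [Subtype.mk.injEq] at h
    have h1 := recover hmn ha hb
    have h2 := recover hmn hc hd
    have h3 := recover hmn.symm hb ha
    have h4 := recover hmn.symm hd hc
    rw [h, h2] at h1
    rw [mul_comm b a, h, mul_comm c d, h4] at h3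
    subst h1 h3
    rfl
  · rintro ⟨I, hI⟩
    have hI' := natCast_mem_of_norm hI
    set A := I ⊔ span {(m : 𝓞 K)} with hA
    set B := I ⊔ span {(n : 𝓞 K)} with hB
    have hmA : (m : 𝓞 K) ∈ A := mem_sup_right (mem_span_singleton_self _)
    have hnB : (n : 𝓞 K) ∈ B := mem_sup_right (mem_span_singleton_self _)
    have hAB : A * B = I := by
      apply le_antisymm
      · rw [hA, hB, Ideal.mul_sup, Ideal.sup_mul, Ideal.sup_mul, span_singleton_mul_span_singleton]
        refine sup_le (sup_le mul_le_left mul_le_right) (sup_le mul_le_left ?_)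
        rw [span_singleton_le_iff_mem]
        exact_mod_cast hI'
      · rw [Ideal.mul_eq_inf_of_coprime (coprime_sup hmn hmA hnB)]
        exact le_inf le_sup_left le_sup_left
    have hN : absNorm A * absNorm B = m * n := by rw [← map_mul, hAB, hI]
    have h1 : absNorm A ∣ m ^ Module.finrank ℤ (𝓞 K) := by
      rw [← absNorm_span_natCast]
      exact absNorm_dvd_absNorm_of_le le_sup_right
    have h2 : absNorm B ∣ n ^ Module.finrank ℤ (𝓞 K) := by
      rw [← absNorm_span_natCast]
      exact absNorm_dvd_absNorm_of_le le_sup_right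
    have h3 : absNorm A ∣ m := by
      refine Nat.Coprime.dvd_of_dvd_mul_right ?_ (Dvd.intro _ hN)
      exact Nat.Coprime.coprime_dvd_left h1 (hmn.pow_left _)
    have h4 : absNorm B ∣ n := by
      refine Nat.Coprime.dvd_of_dvd_mul_left ?_ (Dvd.intro_left _ hN)
      exact Nat.Coprime.coprime_dvd_left h2 (hmn.symm.pow_left _)
    have hm0 : m ≠ 0 := left_ne_zero_of_mul h0
    have hn0 : n ≠ 0 := right_ne_zero_of_mul h0
    have h5 := Nat.le_of_dvd (Nat.pos_of_ne_zero hm0) h3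
    have h6 := Nat.le_of_dvd (Nat.pos_of_ne_zero hn0) h4
    have h7 : absNorm A = m := by
      by_contra h
      have : absNorm A * absNorm B < m * n :=
        Nat.mul_lt_mul_of_lt_of_le (lt_of_le_of_ne h5 h) h6 (Nat.pos_of_ne_zero hn0)
      omega
    have h8 : absNorm B = n := by
      rw [h7] at hN
      exact Nat.eq_of_mul_eq_mul_left (Nat.pos_of_ne_zero hm0) hN
    exact ⟨(⟨A, h7⟩, ⟨B, h8⟩), Subtype.ext hAB⟩

/-- ideals of prime norm correspond to homs to `ZMod q`. -/
lemma rr_prime (q : ℕ) [Fact q.Prime] : rr K q = Nat.card (𝓞 K →+* ZMod q) := by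
  rw [rr]
  symm
  have hsurj : ∀ f : 𝓞 K →+* ZMod q, Function.Surjective f := ZMod.ringHom_surjective
  refine Nat.card_congr (Equiv.ofBijective
    (fun f => ⟨RingHom.ker f, ?_⟩) ⟨?_, ?_⟩)
  · rw [absNorm_apply, Submodule.cardQuot_apply,
      Nat.card_congr (RingHom.quotientKerEquivOfSurjective (hsurj f)).toEquiv, Nat.card_zmod]
  · intro f g h
    simp only [Subtype.mk.injEq] at h
    ext x
    obtain ⟨k, hk⟩ := ZMod.intCast_surjective (f x)
    have h1 : x - (k : 𝓞 K) ∈ RingHom.ker f := by rw [RingHom.mem_ker]; simp [hk]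
    rw [h, RingHom.mem_ker, map_sub, map_intCast, sub_eq_zero] at h1
    rw [h1, hk]
  · rintro ⟨I, hI⟩
    rw [absNorm_apply, Submodule.cardQuot_apply] at hI
    have hq := (Fact.out : q.Prime)
    have : Finite (𝓞 K ⧸ I) := Nat.finite_of_card_ne_zero (by rw [hI]; exact hq.ne_zero)
    have := Fintype.ofFinite (𝓞 K ⧸ I)
    let e := ZMod.ringEquivOfPrime (𝓞 K ⧸ I) hq (by rw [← Nat.card_eq_fintype_card, hI])
    refine ⟨e.symm.toRingHom.comp (Ideal.Quotient.mk I), Subtype.ext ?_⟩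
    ext x
    simp only [RingHom.mem_ker, RingHom.comp_apply]
    rw [← Ideal.Quotient.eq_zero_iff_mem]
    exact map_eq_zero_iff e.symm e.symm.injective

lemma rr_prime' {m : ℕ} (E : OrdA m ≃ₐ[ℤ] 𝓞 K) (q : ℕ) [Fact q.Prime] :
    rr K q = Nat.card {t : ZMod q // t * t = t - m} := by
  rw [rr_prime]
  refine Nat.card_congr ?_
  have e1 : (𝓞 K →+* ZMod q) ≃ (OrdA m →+* ZMod q) :=
    { toFun := fun f => f.comp (E : OrdA m →+* 𝓞 K)
      invFun := fun f => f.comp (E.symm : 𝓞 K →+* OrdA m)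
      left_inv := fun f => by ext x; simp
      right_inv := fun f => by apply RingHom.ext; intro x; simp }
  have e2 : (OrdA m →+* ZMod q) ≃ (OrdA m →ₐ[ℤ] ZMod q) := RingHom.equivIntAlgHom _ _
  refine (e1.trans e2).trans (QuadraticAlgebra.lift.symm.trans ?_)
  refine Equiv.subtypeEquivRight fun t => ?_
  simp
  constructor <;> intro h <;> rw [h] <;> ring

end IdealCount


section RrChi
open NumberField Ideal

variable {K : Type*} [Field K] [NumberField K]

lemma count_odd (p q : ℕ) [Fact p.Prime] [hq : Fact q.Prime] (hp4 : p % 4 = 3) (hq2 : q ≠ 2) :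
    (Nat.card {t : ZMod q // t * t = t - ((p + 1) / 4 : ℕ)} : ℤ) = 1 + legendreSym q (-p) := by
  have h4 : (4 : ZMod q) * ((p + 1) / 4 : ℕ) = p + 1 := by
    have : 4 * ((p + 1) / 4) = p + 1 := by omega
    exact_mod_cast congrArg (fun n : ℕ => (n : ZMod q)) this
  have h2 : (2 : ZMod q) ≠ 0 := by
    intro h
    have : ((2 : ℕ) : ZMod q) = 0 := by exact_mod_cast h
    rw [ZMod.natCast_eq_zero_iff] at this
    exact hq2 ((Nat.prime_dvd_prime_iff_eq hq.out Nat.prime_two).1 this)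
  have := legendreSym.card_sqrts q hq2 (-p)
  rw [add_comm 1 (legendreSym _ _), ← this, Set.toFinset_card, ← Nat.card_eq_fintype_card]
  congr 1
  refine Nat.card_congr (Equiv.ofBijective (fun t => ⟨2 * t.1 - 1, ?_⟩) ⟨?_, ?_⟩)
  · have ht := t.2
    show (2 * t.1 - 1) ^ 2 = ((-p : ℤ) : ZMod q)
    push_cast
    linear_combination 4 * ht - h4
  · intro s t h
    simp only [Subtype.mk.injEq, sub_left_inj] at h
    exact Subtype.ext (mul_left_cancel₀ h2 h)
  · rintro ⟨x, hx⟩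
    have hx' : x ^ 2 = ((-p : ℤ) : ZMod q) := hx
    push_cast at hx'
    refine ⟨⟨(x + 1) / 2, ?_⟩, Subtype.ext ?_⟩
    · have h4' : (4 : ZMod q) ≠ 0 := by
        have : (4 : ZMod q) = 2 * 2 := by norm_num
        rw [this]; exact mul_ne_zero h2 h2
      apply mul_left_cancel₀ h4'
      field_simp
      linear_combination hx' + h4
    · show 2 * ((x + 1) / 2) - 1 = x
      field_simp
      ring

lemma recip (p q : ℕ) [hp : Fact p.Prime] [hq : Fact q.Prime] (hp4 : p % 4 = 3) (hq2 : q ≠ 2) :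
    legendreSym q (-p) = legendreSym p q := by
  have hneg : (-p : ℤ) = (-1) * p := by ring
  rw [hneg, legendreSym.mul, legendreSym.at_neg_one hq2]
  rcases Nat.odd_mod_four_iff.1 ((Nat.Prime.mod_two_eq_one_iff_ne_two hq.out).2 hq2) with h | h
  · rw [ZMod.χ₄_nat_one_mod_four h, one_mul]
    exact (legendreSym.quadratic_reciprocity_one_mod_four h (by rintro rfl; omega)).symm
  · rw [ZMod.χ₄_nat_three_mod_four h, legendreSym.quadratic_reciprocity_three_mod_four hp4 h]
    ring

lemma two_aux0 : Nat.card {t : ZMod 2 // t * t = t - 0} = 2 := by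
  rw [Nat.card_eq_fintype_card]; decide

lemma two_aux1 : Nat.card {t : ZMod 2 // t * t = t - 1} = 0 := by
  rw [Nat.card_eq_fintype_card]; decide

lemma rr_chi {p : ℕ} [hp : Fact p.Prime] (hp4 : p % 4 = 3) (E : OrdA ((p + 1) / 4) ≃ₐ[ℤ] 𝓞 K)
    (q : ℕ) [hq : Fact q.Prime] : (rr K q : ℤ) = 1 + quadraticChar (ZMod p) (q : ZMod p) := by
  rw [rr_prime' E]
  by_cases hq2 : q = 2
  · subst hq2
    have hp2 : p ≠ 2 := by rintro rfl; omega
    have h2 := legendreSym.at_two hp2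
    have h3 : quadraticChar (ZMod p) ((2 : ℕ) : ZMod p) = legendreSym p 2 := by
      simp [legendreSym]
    rw [h3, h2, ZMod.χ₈_nat_eq_if_mod_eight]
    by_cases h8 : p % 8 = 7
    · have hm : (((p + 1) / 4 : ℕ) : ZMod 2) = 0 := by
        rw [ZMod.natCast_eq_zero_iff]; omega
      simp only [hm]
      rw [if_neg (by omega), if_pos (by omega)]
      exact congrArg (Nat.cast : ℕ → ℤ) two_aux0
    · have hm : (((p + 1) / 4 : ℕ) : ZMod 2) = 1 := by
        have h : (((p + 1) / 4 : ℕ) : ZMod 2) = ((1 : ℕ) : ZMod 2) := by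
          rw [ZMod.natCast_eq_natCast_iff]
          show _ % _ = _ % _
          omega
        rw [h, Nat.cast_one]
      simp only [hm]
      rw [if_neg (by omega), if_neg (by omega)]
      exact congrArg (Nat.cast : ℕ → ℤ) two_aux1
  · rw [count_odd p q hp4 hq2, recip p q hp4 hq2]
    simp [legendreSym]

end RrChi


section PrimePow
open NumberField Ideal UniqueFactorizationMonoid

variable {K : Type*} [Field K] [NumberField K]

variable (K) in
/-- primes above `q` -/
abbrev Above (q : ℕ) := {P : Ideal (𝓞 K) // P.IsPrime ∧ (q : 𝓞 K) ∈ P}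

lemma above_ne_bot {q : ℕ} (hq : q.Prime) (P : Above K q) : P.1 ≠ ⊥ := by
  intro h
  have := P.2.2
  rw [h, mem_bot] at this
  exact hq.ne_zero (by exact_mod_cast this)

lemma absNorm_prod_above {q f : ℕ} (hS : ∀ P : Above K q, absNorm P.1 = q ^ f) (s : Multiset (Above K q)) :
    absNorm (s.map Subtype.val).prod = q ^ (f * s.card) := by
  induction s using Multiset.induction with
  | empty => simp
  | cons a s ih =>
    rw [Multiset.map_cons, Multiset.prod_cons, map_mul, ih, hS, Multiset.card_cons, ← pow_add]
    ring

lemma exists_factors {q f j : ℕ} (hq : q.Prime) (hS : ∀ P : Above K q, absNorm P.1 = q ^ f)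
    {I : Ideal (𝓞 K)} (hI : absNorm I = q ^ j) :
    ∃ s : Multiset (Above K q), (s.map Subtype.val).prod = I ∧ f * s.card = j := by
  have hI0 : I ≠ 0 := by
    rintro rfl
    simp at hI
    exact (pow_pos hq.pos j).ne' hI.symm
  have hm : ∀ P ∈ normalizedFactors I, P.IsPrime ∧ (q : 𝓞 K) ∈ P := by
    intro P hP
    have h1 := isPrime_of_prime (prime_of_normalized_factor P hP)
    refine ⟨h1, h1.mem_of_pow_mem j ?_⟩
    have h2 := natCast_mem_of_norm hI
    have h3 := Ideal.le_of_dvd (dvd_of_mem_normalizedFactors hP) h2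
    exact_mod_cast h3
  have hprod : (normalizedFactors I).prod = I := by
    rw [prod_normalizedFactors_eq hI0, normalize_eq]
  lift normalizedFactors I to Multiset (Above K q) using hm with s hs
  refine ⟨s, hprod, ?_⟩
  have := absNorm_prod_above hS s
  rw [hprod, hI] at this
  exact (Nat.pow_right_injective hq.two_le this).symm

lemma rr_sym {q f k : ℕ} (hq : q.Prime) (hf : f ≠ 0)
    (hS : ∀ P : Above K q, absNorm P.1 = q ^ f) :
    rr K (q ^ (f * k)) = (Nat.card (Above K q)).multichoose k := by
  have hfin : Finite (Above K q) := by
    have h := Ideal.finite_setOfPred_absNorm_eq (S := 𝓞 K) (q ^ f)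
    have : Finite {I : Ideal (𝓞 K) // absNorm I = q ^ f} := h
    exact Finite.of_injective (fun P : Above K q => (⟨P.1, hS P⟩ : {I // absNorm I = q ^ f}))
      (fun P Q h => Subtype.ext (by simpa using h))
  have := Fintype.ofFinite (Above K q)
  classical
  rw [Nat.card_eq_fintype_card, ← Sym.card_sym_eq_multichoose, ← Nat.card_eq_fintype_card, rr]
  symm
  refine Nat.card_congr (Equiv.ofBijective
    (fun s => ⟨(s.1.map Subtype.val).prod, by rw [absNorm_prod_above hS, s.2]⟩) ⟨?_, ?_⟩)
  · rintro ⟨s, hs⟩ ⟨t, ht⟩ h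
    simp only [Subtype.mk.injEq] at h
    have hpr : ∀ s : Multiset (Above K q), normalizedFactors (s.map Subtype.val).prod
        = s.map Subtype.val := by
      intro s
      apply normalizedFactors_prod_of_prime
      intro P hP
      obtain ⟨Q, _, rfl⟩ := Multiset.mem_map.1 hP
      exact prime_of_isPrime (above_ne_bot hq Q) Q.2.1
    have h2 := hpr s
    rw [h, hpr t] at h2
    exact Subtype.ext (Multiset.map_injective Subtype.val_injective h2.symm)
  · rintro ⟨I, hI⟩
    obtain ⟨s, h1, h2⟩ := exists_factors hq hS hI
    exact ⟨⟨s, Nat.eq_of_mul_eq_mul_left (Nat.pos_of_ne_zero hf) h2⟩, Subtype.ext h1⟩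

lemma span_eq_of_norm {q : ℕ} (hq : q.Prime) (h2 : Module.finrank ℤ (𝓞 K) = 2) {P : Ideal (𝓞 K)}
    (hP : (q : 𝓞 K) ∈ P) (hN : absNorm P = q ^ 2) : P = span {(q : 𝓞 K)} := by
  have hd : P ∣ span {(q : 𝓞 K)} := by
    rw [Ideal.dvd_iff_le, span_singleton_le_iff_mem]; exact hP
  obtain ⟨J, hJ⟩ := hd
  have h := congrArg absNorm hJ
  rw [map_mul, absNorm_span_natCast, h2, hN] at h
  have h1 : absNorm J = 1 := by
    have := pow_pos hq.pos 2
    exact (Nat.eq_of_mul_eq_mul_left this (by rw [mul_one]; exact h)).symm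
  rw [absNorm_eq_one_iff] at h1
  rw [hJ, h1, mul_top]

lemma norm_above {q : ℕ} (hq : q.Prime) (h2 : Module.finrank ℤ (𝓞 K) = 2) (P : Above K q) :
    absNorm P.1 = q ∨ absNorm P.1 = q ^ 2 := by
  have h : absNorm P.1 ∣ q ^ 2 := by
    rw [← h2, ← absNorm_span_natCast]
    exact absNorm_dvd_absNorm_of_le ((span_singleton_le_iff_mem _).2 P.2.2)
  obtain ⟨k, hk, he⟩ := (Nat.dvd_prime_pow hq).1 h
  interval_cases k
  · rw [pow_zero, absNorm_eq_one_iff] at he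
    exact absurd he P.2.1.ne_top
  · left; simpa using he
  · right; exact he

lemma above_of_norm {q : ℕ} (hq : q.Prime) {P : Ideal (𝓞 K)} (h : absNorm P = q) :
    P.IsPrime ∧ (q : 𝓞 K) ∈ P :=
  ⟨isPrime_of_irreducible_absNorm (by rw [h]; exact hq), natCast_mem_of_norm h⟩

lemma rr_pow_of_ne {q k : ℕ} (hq : q.Prime) (h2 : Module.finrank ℤ (𝓞 K) = 2) (hr : rr K q ≠ 0) :
    rr K (q ^ k) = (rr K q).multichoose k := by
  obtain ⟨Q, hQ⟩ : Nonempty {I : Ideal (𝓞 K) // absNorm I = q} := (Nat.card_ne_zero.1 hr).1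
  have hS : ∀ P : Above K q, absNorm P.1 = q ^ 1 := by
    intro P
    rw [pow_one]
    rcases norm_above hq h2 P with h | h
    · exact h
    · have h3 := span_eq_of_norm hq h2 P.2.2 h
      have h4 : P.1 ≤ Q := by
        rw [h3, span_singleton_le_iff_mem]; exact natCast_mem_of_norm hQ
      have h5 := (P.2.1.isMaximal (above_ne_bot hq P)).eq_of_le (above_of_norm hq hQ).1.ne_top h4
      rw [h5, hQ]
  have h := rr_sym (k := k) hq one_ne_zero hS
  rw [one_mul] at h
  rw [h]
  congr 1
  rw [rr]
  refine Nat.card_congr (Equiv.subtypeEquivRight fun P => ⟨fun h => ?_, above_of_norm hq⟩)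
  simpa using hS ⟨P, h⟩

lemma rr_pow_of_eq {q k : ℕ} (hq : q.Prime) (h2 : Module.finrank ℤ (𝓞 K) = 2) (hr : rr K q = 0) :
    rr K (q ^ k) = if Even k then 1 else 0 := by
  have hfin : Finite {I : Ideal (𝓞 K) // absNorm I = q} :=
    Ideal.finite_setOfPred_absNorm_eq (S := 𝓞 K) q
  have hem : IsEmpty {I : Ideal (𝓞 K) // absNorm I = q} := by
    rcases Nat.card_eq_zero.1 hr with h | h
    · exact h
    · exact absurd hfin h.not_finite
  have hS : ∀ P : Above K q, absNorm P.1 = q ^ 2 := by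
    intro P
    rcases norm_above hq h2 P with h | h
    · exact hem.elim ⟨P.1, h⟩
    · exact h
  split_ifs with hk
  · obtain ⟨i, rfl⟩ := hk
    rw [← two_mul, rr_sym hq two_ne_zero hS]
    have : Nat.card (Above K q) = 1 := by
      rw [Nat.card_eq_one_iff_unique]
      refine ⟨⟨fun P Q => Subtype.ext ?_⟩, ?_⟩
      · rw [span_eq_of_norm hq h2 P.2.2 (hS P), span_eq_of_norm hq h2 Q.2.2 (hS Q)]
      · have hne : span {(q : 𝓞 K)} ≠ ⊤ := by
          intro h
          rw [← absNorm_eq_one_iff, absNorm_span_natCast, h2] at h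
          have := hq.two_le
          nlinarith
        obtain ⟨M, hM, hle⟩ := exists_le_maximal _ hne
        exact ⟨⟨M, hM.isPrime, hle (mem_span_singleton_self _)⟩⟩
    rw [this, Nat.multichoose_one]
  · rw [rr, Nat.card_eq_zero]
    left
    refine ⟨fun I => hk ?_⟩
    obtain ⟨s, _, h⟩ := exists_factors hq hS I.2
    exact ⟨s.card, by omega⟩

lemma rr_pow_chi {p : ℕ} [hp : Fact p.Prime] (hp4 : p % 4 = 3)
    (E : OrdA ((p + 1) / 4) ≃ₐ[ℤ] 𝓞 K) (q k : ℕ) (hq : q.Prime) :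
    (rr K (q ^ k) : ℤ) = ∑ i ∈ Finset.range (k + 1), quadraticChar (ZMod p) (q ^ i : ℕ) := by
  have := Fact.mk hq
  have h := rr_chi hp4 E q
  have h2 := finrank_of_equiv E
  simp only [Nat.cast_pow, map_pow]
  rcases quadraticChar_isQuadratic (ZMod p) (q : ZMod p) with hc | hc | hc
  · rw [hc] at h ⊢
    have h1 : rr K q = 1 := by exact_mod_cast h
    rw [rr_pow_of_ne hq h2 (by omega), h1, Nat.multichoose_one, Finset.sum_range_succ']
    simp
  · rw [hc] at h ⊢
    have h1 : rr K q = 2 := by exact_mod_cast h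
    rw [rr_pow_of_ne hq h2 (by omega), h1, Nat.multichoose_two]
    simp
  · rw [hc] at h ⊢
    have h1 : rr K q = 0 := by omega
    rw [rr_pow_of_eq hq h2 h1, neg_one_geom_sum]
    by_cases hk : Even k <;> simp [hk, Nat.even_add_one]

end PrimePow


section ZetaFactor
open NumberField Ideal ArithmeticFunction

variable {K : Type*} [Field K] [NumberField K]

/-- the quadratic character as a complex Dirichlet character -/
noncomputable def chiC (p : ℕ) [Fact p.Prime] : DirichletCharacter ℂ p :=
  (quadraticChar (ZMod p)).ringHomComp (Int.castRingHom ℂ)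

lemma chiC_apply (p : ℕ) [Fact p.Prime] (x : ZMod p) :
    chiC p x = ((quadraticChar (ZMod p) x : ℤ) : ℂ) := rfl

variable (K) in
/-- ideal counting as an arithmetic function -/
noncomputable def rA : ArithmeticFunction ℂ := ⟨fun n => if n = 0 then 0 else (rr K n : ℂ), if_pos rfl⟩

/-- the character as an arithmetic function -/
noncomputable def chiA (p : ℕ) [Fact p.Prime] : ArithmeticFunction ℂ :=
  ⟨fun n => if n = 0 then 0 else chiC p n, if_pos rfl⟩

lemma rA_apply {n : ℕ} (h : n ≠ 0) : rA K n = rr K n := if_neg h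

lemma chiA_apply (p : ℕ) [Fact p.Prime] {n : ℕ} (h : n ≠ 0) : chiA p n = chiC p n := if_neg h

lemma rA_mult : (rA K).IsMultiplicative := by
  rw [IsMultiplicative.iff_ne_zero]
  refine ⟨by rw [rA_apply one_ne_zero, rr_one, Nat.cast_one], fun {m n} hm hn hc => ?_⟩
  rw [rA_apply (mul_ne_zero hm hn), rA_apply hm, rA_apply hn, rr_mul hc (mul_ne_zero hm hn),
    Nat.cast_mul]

lemma chiA_mult (p : ℕ) [Fact p.Prime] : (chiA p).IsMultiplicative := by
  rw [IsMultiplicative.iff_ne_zero]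
  refine ⟨by rw [chiA_apply p one_ne_zero, Nat.cast_one, map_one], fun {m n} hm hn hc => ?_⟩
  rw [chiA_apply p (mul_ne_zero hm hn), chiA_apply p hm, chiA_apply p hn,
    Nat.cast_mul, map_mul]

lemma rA_eq {p : ℕ} [hp : Fact p.Prime] (hp4 : p % 4 = 3)
    (E : OrdA ((p + 1) / 4) ≃ₐ[ℤ] 𝓞 K) : rA K = (zeta : ArithmeticFunction ℂ) * chiA p := by
  rw [IsMultiplicative.eq_iff_eq_on_prime_powers _ rA_mult _
    (isMultiplicative_zeta.natCast.mul (chiA_mult p))]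
  intro q k hq
  rw [coe_zeta_mul_apply, Nat.sum_divisors_prime_pow hq, rA_apply (pow_ne_zero _ hq.ne_zero)]
  have h := rr_pow_chi hp4 E q k hq
  have h' : ((rr K (q ^ k) : ℤ) : ℂ) = _ := congrArg (Int.cast : ℤ → ℂ) h
  rw [Int.cast_natCast] at h'
  rw [h', Int.cast_sum]
  refine Finset.sum_congr rfl fun i _ => ?_
  rw [chiA_apply p (pow_ne_zero _ hq.ne_zero), chiC_apply]

lemma zeta_factor {p : ℕ} [hp : Fact p.Prime] (hp4 : p % 4 = 3)
    (E : OrdA ((p + 1) / 4) ≃ₐ[ℤ] 𝓞 K) {s : ℂ} (hs : 1 < s.re) :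
    dedekindZeta K s = riemannZeta s * DirichletCharacter.LFunction (chiC p) s := by
  rw [DirichletCharacter.LFunction_eq_LSeries _ hs, ← LSeries_zeta_eq_riemannZeta hs]
  have h1 : LSeries (fun n => chiC p n) s = LSeries (fun n => chiA p n) s :=
    LSeries_congr (fun {n} hn => (chiA_apply p hn).symm) s
  have h2 : dedekindZeta K s = LSeries (fun n => rA K n) s :=
    LSeries_congr (fun {n} hn => (rA_apply hn).symm) s
  have hsum : LSeriesSummable (fun n => chiA p n) s :=
    (LSeriesSummable_congr s (fun {n} hn => (chiA_apply p hn))).2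
      ((chiC p).LSeriesSummable_of_one_lt_re hs)
  have hz : LSeriesSummable (fun n => (zeta : ArithmeticFunction ℂ) n) s := by
    simpa using LSeriesSummable_zeta_iff.2 hs
  rw [h2, h1, rA_eq hp4 E, LSeries_mul' hz hsum]
  simp

lemma chiC_ne_one {p : ℕ} [hp : Fact p.Prime] (hp4 : p % 4 = 3) : chiC p ≠ 1 := by
  intro h
  have h1 := DFunLike.congr_fun h (-1)
  rw [chiC_apply, quadraticChar_neg_one (by rw [ZMod.ringChar_zmod_n]; rintro rfl; omega),
    ZMod.card, ZMod.χ₄_nat_three_mod_four hp4, MulChar.one_apply (by simp)] at h1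
  norm_num at h1

open Filter Topology in
lemma LOne {p : ℕ} [hp : Fact p.Prime] (hp3 : 3 < p) (hp4 : p % 4 = 3) {θ : K}
    (hθ : θ ^ 2 = -(p : K)) (hgen : ∀ y : K, y ∈ Algebra.adjoin ℚ ({θ} : Set K)) :
    DirichletCharacter.LFunction (chiC p) 1 = Real.pi * classNumber K / Real.sqrt p := by
  obtain ⟨E⟩ := exists_equiv hp.out hp4 hθ hgen
  have h1 := tendsto_sub_one_mul_dedekindZeta_nhdsGT K
  rw [residue_eq hp.out hp3 hp4 hθ hgen] at h1
  have hc : Tendsto (fun s : ℝ => (s : ℂ)) (𝓝[>] 1) (𝓝 1) :=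
    (Complex.continuous_ofReal.tendsto' 1 1 Complex.ofReal_one).mono_left nhdsWithin_le_nhds
  have hc' : Tendsto (fun s : ℝ => (s : ℂ)) (𝓝[>] 1) (𝓝[≠] 1) := by
    rw [tendsto_nhdsWithin_iff]
    refine ⟨hc, ?_⟩
    filter_upwards [self_mem_nhdsWithin] with s hs
    have hs' : (1 : ℝ) < s := hs
    simp only [Set.mem_compl_iff, Set.mem_singleton_iff]
    intro h
    have : s = 1 := by exact_mod_cast h
    linarith
  have h2 := riemannZeta_residue_one.comp hc'
  have h3 : Tendsto (fun s : ℝ => DirichletCharacter.LFunction (chiC p) s) (𝓝[>] 1)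
      (𝓝 (DirichletCharacter.LFunction (chiC p) 1)) :=
    ((DirichletCharacter.differentiableAt_LFunction (chiC p) 1
      (Or.inr (chiC_ne_one hp4))).continuousAt.tendsto).comp hc
  have h4 := h2.mul h3
  rw [one_mul] at h4
  refine (tendsto_nhds_unique (h1.congr' ?_) h4).symm.trans (by push_cast; rfl)
  filter_upwards [self_mem_nhdsWithin] with s hs
  have hs' : (1 : ℝ) < s := hs
  rw [zeta_factor hp4 E (by simpa using hs'), ← mul_assoc]
  rfl

end ZetaFactor


section LZero
open Filter Topology Asymptotics Set

variable (p : ℕ) [Fact p.Prime]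

/-- real quadratic character on naturals -/
noncomputable def cR (n : ℕ) : ℝ := ((quadraticChar (ZMod p) (n : ZMod p) : ℤ) : ℝ)

/-- numerator -/
noncomputable def AA (t : ℝ) : ℝ := ∑ j ∈ Finset.range p, cR p j * Real.exp (-j * t)

/-- value at zero -/
noncomputable def F0 : ℝ := -(∑ j ∈ Finset.range p, cR p j * j) / p

/-- Mellin kernel -/
noncomputable def FF (t : ℝ) : ℝ := AA p t / (1 - Real.exp (-p * t))

/-- regularized kernel -/
noncomputable def GG (t : ℝ) : ℝ := FF p t - F0 p * Real.exp (-t)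

lemma cR_zero : cR p 0 = 0 := by simp [cR]

lemma cR_abs (n : ℕ) : |cR p n| ≤ 1 := by
  rw [cR]
  rcases quadraticChar_isQuadratic (ZMod p) (n : ZMod p) with hc | hc | hc <;> rw [hc] <;> simp

lemma cR_add (n : ℕ) : cR p (n + p) = cR p n := by simp [cR]

lemma sum_range_zmod {M : Type*} [AddCommMonoid M] (f : ZMod p → M) :
    ∑ j ∈ Finset.range p, f (j : ZMod p) = ∑ x : ZMod p, f x := by
  have : NeZero p := ⟨(Fact.out : p.Prime).ne_zero⟩
  refine Finset.sum_bij' (fun j _ => (j : ZMod p)) (fun x _ => x.val) ?_ ?_ ?_ ?_ ?_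
  · simp
  · intro x _; simpa using x.val_lt
  · intro j hj; exact ZMod.val_cast_of_lt (by simpa using hj)
  · intro x _; exact ZMod.natCast_zmod_val x
  · simp

lemma cR_sum (hp4 : p % 4 = 3) : ∑ j ∈ Finset.range p, cR p j = 0 := by
  have h := sum_range_zmod p (fun x => ((quadraticChar (ZMod p) x : ℤ) : ℝ))
  have h2 := quadraticChar_sum_zero (F := ZMod p)
    (by rw [ZMod.ringChar_zmod_n]; rintro rfl; omega)
  have h3 : ∑ x : ZMod p, ((quadraticChar (ZMod p) x : ℤ) : ℝ) = 0 := by exact_mod_cast h2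
  exact h.trans h3

lemma den_lb {t : ℝ} (ht : 0 < t) : t / (1 + t) ≤ 1 - Real.exp (-p * t) := by
  have hp1 : (1 : ℝ) ≤ p := by exact_mod_cast (Fact.out : p.Prime).one_lt.le
  have h1 : Real.exp (-p * t) ≤ Real.exp (-t) := Real.exp_le_exp.2 (by nlinarith)
  have h2 : Real.exp (-t) ≤ (1 + t)⁻¹ := by
    rw [Real.exp_neg]
    apply inv_anti₀ (by positivity)
    linarith [Real.add_one_le_exp t]
  have h3 : t / (1 + t) = 1 - (1 + t)⁻¹ := by field_simp; ring
  linarith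

lemma den_pos {t : ℝ} (ht : 0 < t) : 0 < 1 - Real.exp (-p * t) :=
  lt_of_lt_of_le (by positivity) (den_lb p ht)

lemma FF_hasSum {t : ℝ} (ht : 0 < t) : HasSum (fun n : ℕ => cR p n * Real.exp (-n * t)) (FF p t) := by
  have hs : Summable (fun n : ℕ => cR p n * Real.exp (-n * t)) := by
    refine Summable.of_norm_bounded (g := fun n : ℕ => Real.exp (-t) ^ n)
      (summable_geometric_of_lt_one (Real.exp_pos _).le (by simpa using ht)) fun n => ?_
    rw [norm_mul, Real.norm_eq_abs, Real.norm_of_nonneg (Real.exp_pos _).le, ← Real.exp_nat_mul]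
    have : -(n : ℝ) * t = n * -t := by ring
    rw [this]
    exact mul_le_of_le_one_left (Real.exp_pos _).le (cR_abs p n)
  have h := hs.sum_add_tsum_nat_add p
  have h2 : ∀ n : ℕ, cR p (n + p) * Real.exp (-((n + p : ℕ) : ℝ) * t) =
      Real.exp (-p * t) * (cR p n * Real.exp (-n * t)) := by
    intro n
    rw [cR_add]
    have : -((n + p : ℕ) : ℝ) * t = -p * t + -n * t := by push_cast; ring
    rw [this, Real.exp_add]; ring
  simp_rw [h2] at h
  rw [tsum_mul_left] at h
  have h3 : FF p t = ∑' n : ℕ, cR p n * Real.exp (-n * t) := by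
    rw [FF, div_eq_iff (den_pos p ht).ne', AA]
    linear_combination h
  rw [h3]
  exact hs.hasSum

/-- second order remainder of exp -/
noncomputable def rem (x : ℝ) : ℝ := Real.exp (-x) - 1 + x

lemma rem_bigO (c : ℝ) : (fun t => rem (c * t)) =O[𝓝[>] 0] (fun t : ℝ => t ^ 2) := by
  refine IsBigO.of_bound (c ^ 2) ?_
  have h : ∀ᶠ t in 𝓝[>] (0 : ℝ), |c * t| < 1 := by
    refine nhdsWithin_le_nhds ?_
    have : Tendsto (fun t : ℝ => |c * t|) (𝓝 0) (𝓝 0) := by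
      have : Continuous (fun t : ℝ => |c * t|) := by fun_prop
      simpa using this.tendsto 0
    exact this.eventually_lt_const one_pos
  filter_upwards [h] with t ht
  have h1 := Real.abs_exp_sub_one_sub_id_le (x := -(c * t)) (by rw [abs_neg]; exact ht.le)
  rw [Real.norm_eq_abs, Real.norm_of_nonneg (sq_nonneg t), rem]
  calc |Real.exp (-(c * t)) - 1 + c * t| = |Real.exp (-(c * t)) - 1 - -(c * t)| := by ring_nf
    _ ≤ _ := h1
    _ = c ^ 2 * t ^ 2 := by ring

lemma GG_eq (hp4 : p % 4 = 3) {t : ℝ} (ht : 0 < t) : GG p t =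
    ((∑ j ∈ Finset.range p, cR p j * rem (j * t)) - F0 p * (rem (1 * t) - rem ((p + 1) * t)))
      * (1 - Real.exp (-p * t))⁻¹ := by
  have hd := (den_pos p ht).ne'
  have hp0 : (p : ℝ) ≠ 0 := by exact_mod_cast (Fact.out : p.Prime).ne_zero
  rw [GG, FF, ← div_eq_mul_inv, eq_div_iff hd, sub_mul, div_mul_cancel₀ _ hd]
  have h1 : AA p t = ∑ j ∈ Finset.range p, cR p j * rem (j * t) +
      ∑ j ∈ Finset.range p, cR p j - t * ∑ j ∈ Finset.range p, cR p j * j := by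
    rw [AA, Finset.mul_sum, ← Finset.sum_add_distrib, ← Finset.sum_sub_distrib]
    refine Finset.sum_congr rfl fun j _ => ?_
    rw [rem, neg_mul]; ring
  have h2 : ∑ j ∈ Finset.range p, cR p j * j = -F0 p * p := by rw [F0]; field_simp
  rw [h1, cR_sum p hp4, h2, rem, rem]
  have h3 : Real.exp (-((p + 1) * t)) = Real.exp (-t) * Real.exp (-p * t) := by
    rw [← Real.exp_add]; congr 1; ring
  rw [h3, one_mul]
  ring

lemma inv_den_bigO_zero : (fun t : ℝ => (1 - Real.exp (-p * t))⁻¹) =O[𝓝[>] 0] (fun t : ℝ => t⁻¹) := by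
  refine IsBigO.of_bound 2 ?_
  have h : Ioo (0 : ℝ) 1 ∈ 𝓝[>] (0 : ℝ) := Ioo_mem_nhdsGT one_pos
  filter_upwards [h] with t ht
  rw [Real.norm_of_nonneg (inv_nonneg.2 (den_pos p ht.1).le), Real.norm_of_nonneg (inv_nonneg.2 ht.1.le)]
  have h1 := den_lb p ht.1
  have h2 : t / 2 ≤ t / (1 + t) := div_le_div_of_nonneg_left ht.1.le (by linarith [ht.1]) (by linarith [ht.2])
  calc (1 - Real.exp (-p * t))⁻¹ ≤ (t / 2)⁻¹ := inv_anti₀ (by linarith [ht.1]) (h2.trans h1)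
    _ = 2 * t⁻¹ := by rw [inv_div, div_eq_mul_inv]

lemma GG_bigO_zero (hp4 : p % 4 = 3) : (GG p) =O[𝓝[>] 0] (fun t : ℝ => t ^ (-(-1 : ℝ))) := by
  have h1 : (fun t => (∑ j ∈ Finset.range p, cR p j * rem (j * t)) -
      F0 p * (rem (1 * t) - rem ((p + 1) * t))) =O[𝓝[>] 0] (fun t : ℝ => t ^ 2) :=
    (IsBigO.fun_sum fun (j : ℕ) _ => (rem_bigO (j : ℝ)).const_mul_left (cR p j)).sub
      (((rem_bigO 1).sub (rem_bigO (p + 1))).const_mul_left _)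
  refine (h1.mul (inv_den_bigO_zero p)).congr' ?_ ?_
  · filter_upwards [self_mem_nhdsWithin] with t ht
    exact (GG_eq p hp4 ht).symm
  · filter_upwards [self_mem_nhdsWithin] with t ht
    have : t ≠ 0 := (show (0 : ℝ) < t from ht).ne'
    rw [neg_neg, Real.rpow_one]
    field_simp

lemma GG_bigO_top : (GG p) =O[atTop] (fun t : ℝ => Real.exp (-1 * t)) := by
  have h0 : (fun t : ℝ => (1 - Real.exp (-p * t))⁻¹) =O[atTop] (fun _ : ℝ => (1 : ℝ)) := by
    refine IsBigO.of_bound 2 ?_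
    filter_upwards [eventually_ge_atTop 1] with t ht
    have ht0 : 0 < t := by linarith
    rw [Real.norm_of_nonneg (inv_nonneg.2 (den_pos p ht0).le)]
    have h1 := den_lb p ht0
    have h2 : (1 : ℝ) / 2 ≤ t / (1 + t) := by rw [div_le_div_iff₀ (by norm_num) (by linarith)]; linarith
    calc (1 - Real.exp (-p * t))⁻¹ ≤ (1 / 2)⁻¹ := inv_anti₀ (by norm_num) (h2.trans h1)
      _ = _ := by norm_num
  have h1 : (AA p) =O[atTop] (fun t : ℝ => Real.exp (-1 * t)) := by
    have : AA p = fun t => ∑ j ∈ Finset.range p, cR p j * Real.exp (-j * t) := rfl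
    rw [this]
    refine IsBigO.fun_sum fun j _ => ?_
    rcases Nat.eq_zero_or_pos j with rfl | hj
    · simp only [cR_zero, zero_mul]
      exact isBigO_zero _ _
    · refine IsBigO.const_mul_left ?_ _
      refine IsBigO.of_bound 1 ?_
      filter_upwards [eventually_ge_atTop 0] with t ht
      rw [Real.norm_of_nonneg (Real.exp_pos _).le, Real.norm_of_nonneg (Real.exp_pos _).le, one_mul]
      have : (1 : ℝ) ≤ j := by exact_mod_cast hj
      exact Real.exp_le_exp.2 (by nlinarith)
  have h2 := h1.mul h0
  simp only [mul_one] at h2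
  have h3 : (fun t : ℝ => F0 p * Real.exp (-t)) =O[atTop] (fun t : ℝ => Real.exp (-1 * t)) := by
    simp only [neg_one_mul]
    exact (isBigO_refl _ _).const_mul_left _
  exact (h2.sub h3).congr_left (fun t => by rw [GG, FF, div_eq_mul_inv])

lemma GG_cont : ContinuousOn (GG p) (Ioi 0) := by
  unfold GG FF AA
  refine ContinuousOn.sub (ContinuousOn.div ?_ ?_ ?_) ?_
  · fun_prop
  · fun_prop
  · intro t ht; exact (den_pos p ht).ne'
  · fun_prop

/-- complex kernel -/
noncomputable def GC (t : ℝ) : ℂ := ((GG p t : ℝ) : ℂ)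

lemma GC_loc : MeasureTheory.LocallyIntegrableOn (GC p) (Ioi 0) := by
  apply ContinuousOn.locallyIntegrableOn _ measurableSet_Ioi
  exact Complex.continuous_ofReal.comp_continuousOn (GG_cont p)

lemma GC_top : (GC p) =O[atTop] (fun t : ℝ => Real.exp (-1 * t)) := by
  unfold GC
  exact Complex.isBigO_ofReal_left.2 (GG_bigO_top p)

lemma GC_zero (hp4 : p % 4 = 3) : (GC p) =O[𝓝[>] 0] (fun t : ℝ => t ^ (-(-1 : ℝ))) := by
  unfold GC
  exact Complex.isBigO_ofReal_left.2 (GG_bigO_zero p hp4)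

lemma GC_diff (hp4 : p % 4 = 3) {s : ℂ} (hs : -1 < s.re) : DifferentiableAt ℂ (mellin (GC p)) s :=
  mellin_differentiableAt_of_isBigO_rpow_exp one_pos (GC_loc p) (GC_top p) (GC_zero p hp4) hs

lemma mellin_FF (hp4 : p % 4 = 3) {s : ℂ} (hs : 0 < s.re) :
    mellin (fun t => ((FF p t : ℝ) : ℂ)) s = mellin (GC p) s + F0 p * Complex.Gamma s := by
  have h1 : MellinConvergent (GC p) s :=
    mellinConvergent_of_isBigO_rpow_exp one_pos (GC_loc p) (GC_top p) (GC_zero p hp4)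
      (by linarith)
  have h2 : MellinConvergent (fun t : ℝ => ((Real.exp (-t) : ℝ) : ℂ)) s := by
    have := Complex.GammaIntegral_convergent hs
    rw [MellinConvergent]
    refine this.congr_fun (fun t _ => ?_) measurableSet_Ioi
    simp only [smul_eq_mul]; ring
  have h3 := hasMellin_add h1 (h2.const_smul (F0 p : ℂ))
  have h4 := h3.2
  rw [mellin_const_smul, ← Complex.GammaIntegral_eq_mellin, ← Complex.Gamma_eq_integral hs, smul_eq_mul] at h4
  rw [← h4]
  congr 1
  funext t
  simp only [GC, GG, smul_eq_mul]
  push_cast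
  ring

lemma mellin_FF_L {s : ℂ} (hs : 1 < s.re) :
    mellin (fun t => ((FF p t : ℝ) : ℂ)) s = Complex.Gamma s * DirichletCharacter.LFunction (chiC p) s := by
  have : NeZero p := ⟨(Fact.out : p.Prime).ne_zero⟩
  rw [DirichletCharacter.LFunction_eq_LSeries _ hs]
  have hsm := (chiC p).LSeriesSummable_of_one_lt_re hs
  have h := hasSum_mellin (a := fun n : ℕ => chiC p n) (p := fun n : ℕ => (n : ℝ))
    (F := fun t => ((FF p t : ℝ) : ℂ)) (s := s) ?_ (by linarith) ?_ ?_
  · have h1 := (hsm.LSeriesHasSum).mul_left (Complex.Gamma s)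
    refine HasSum.unique h ?_
    convert! h1 using 2 with n
    rcases Nat.eq_zero_or_pos n with rfl | hn
    · simp [chiC_apply]
    · rw [LSeries.term_of_ne_zero hn.ne', mul_div_assoc]
      simp
  · intro n
    rcases Nat.eq_zero_or_pos n with rfl | hn
    · left; simp [chiC_apply]
    · right; exact_mod_cast hn
  · intro t ht
    have := FF_hasSum p ht
    have h2 := Complex.hasSum_ofReal.2 this
    convert! h2 using 2 with n
    rw [chiC_apply, cR]
    push_cast
    rfl
  · have := hsm.norm
    refine this.congr fun n => ?_
    rcases Nat.eq_zero_or_pos n with rfl | hn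
    · simp [chiC_apply]
    · rw [LSeries.norm_term_eq, if_neg hn.ne']

lemma LZero_eq (hp4 : p % 4 = 3) : DirichletCharacter.LFunction (chiC p) 0 = F0 p := by
  have : NeZero p := ⟨(Fact.out : p.Prime).ne_zero⟩
  let U : Set ℂ := {s | -1 < s.re}
  have hU : IsOpen U := isOpen_lt continuous_const Complex.continuous_re
  have hUc : IsPreconnected U := (convex_halfSpace_re_gt (-1)).isPreconnected
  let f : ℂ → ℂ := fun s => Complex.Gamma (s + 1) *
    (DirichletCharacter.LFunction (chiC p) s - F0 p)
  let g : ℂ → ℂ := fun s => s * mellin (GC p) s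
  have hf : AnalyticOnNhd ℂ f U := by
    refine DifferentiableOn.analyticOnNhd (fun s hs => ?_) hU
    refine DifferentiableAt.differentiableWithinAt ?_
    refine DifferentiableAt.mul ?_ ?_
    · refine DifferentiableAt.comp (g := Complex.Gamma) s ?_ (by fun_prop)
      refine Complex.differentiableAt_Gamma _ fun m h => ?_
      have h1 := congrArg Complex.re h
      have h2 : -1 < s.re := hs
      simp at h1
      have h3 : (0 : ℝ) ≤ m := m.cast_nonneg
      linarith
    · exact (DirichletCharacter.differentiableAt_LFunction (chiC p) s
        (Or.inr (chiC_ne_one hp4))).sub_const _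
  have hg : AnalyticOnNhd ℂ g U := by
    refine DifferentiableOn.analyticOnNhd (fun s hs => ?_) hU
    exact (differentiableAt_id.mul (GC_diff p hp4 hs)).differentiableWithinAt
  have h2U : (2 : ℂ) ∈ U := by simp [U]; norm_num
  have hev : f =ᶠ[𝓝 2] g := by
    have : {s : ℂ | 1 < s.re} ∈ 𝓝 (2 : ℂ) :=
      (isOpen_lt continuous_const Complex.continuous_re).mem_nhds (by simp)
    filter_upwards [this] with s hs
    have hs' : 1 < s.re := hs
    have h1 := mellin_FF p hp4 (s := s) (by linarith)
    rw [mellin_FF_L p hs'] at h1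
    have hs0 : s ≠ 0 := by rintro rfl; simp at hs'; linarith
    simp only [f, g]
    rw [Complex.Gamma_add_one s hs0]
    linear_combination s * h1
  have h := hf.eqOn_of_preconnected_of_eventuallyEq hg hUc h2U hev
  have h0 : f 0 = g 0 := h (by simp [U])
  simp only [f, g, zero_add, Complex.Gamma_one, one_mul, zero_mul] at h0
  exact sub_eq_zero.1 h0

end LZero


section ClassNo
open NumberField

variable (p : ℕ) [Fact p.Prime]

lemma quadChar_neg (hp4 : p % 4 = 3) (x : ZMod p) :
    quadraticChar (ZMod p) (-x) = - quadraticChar (ZMod p) x := by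
  have h : quadraticChar (ZMod p) (-1) = -1 := by
    rw [quadraticChar_neg_one (by rw [ZMod.ringChar_zmod_n]; rintro rfl; omega),
      ZMod.card, ZMod.χ₄_nat_three_mod_four hp4]
  rw [← neg_one_mul, map_mul, h, neg_one_mul]

lemma dft_chi (hp4 : p % 4 = 3) (k : ZMod p) :
    ZMod.dft (fun x => chiC p x) k = -(Complex.I * (Real.sqrt p : ℂ)) * chiC p k := by
  have hG := gauss_sign (p := p) hp4
  rw [ZMod.dft_apply]
  simp only [smul_eq_mul]
  by_cases hk : k = 0
  · subst hk
    simp only [mul_zero, neg_zero, AddChar.map_zero_eq_one, one_mul]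
    have h2 := quadraticChar_sum_zero (F := ZMod p)
      (by rw [ZMod.ringChar_zmod_n]; rintro rfl; omega)
    have h3 : ∑ x : ZMod p, chiC p x = 0 := by
      simp only [chiC_apply]; exact_mod_cast h2
    rw [h3]
    simp [chiC_apply]
  · have hk' : -k ≠ 0 := neg_ne_zero.2 hk
    rw [← hG, ← Equiv.sum_comp (Equiv.mulRight₀ (-k) hk')
      (fun j => ((quadraticChar (ZMod p) j : ℤ) : ℂ) * ZMod.stdAddChar j), ← Finset.sum_neg_distrib,
      Finset.sum_mul]
    refine Finset.sum_congr rfl fun i _ => ?_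
    have hsq : (((quadraticChar (ZMod p) k : ℤ) : ℂ)) ^ 2 = 1 := by
      exact_mod_cast quadraticChar_sq_one hk
    have hi : (Equiv.mulRight₀ (-k) hk') i = i * -k := rfl
    simp only [hi, mul_neg, quadChar_neg p hp4, map_mul, chiC_apply]
    push_cast
    linear_combination (-((quadraticChar (ZMod p) i : ℤ) : ℂ) * ZMod.stdAddChar (-(i * k))) * hsq

lemma chi_neg_fun (hp4 : p % 4 = 3) : (fun x => chiC p (-x)) = -(fun x => chiC p x) := by
  funext x
  simp [chiC_apply, quadChar_neg p hp4]

lemma LFun_eq (hp4 : p % 4 = 3) : DirichletCharacter.LFunction (chiC p) 0 =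
    (Real.sqrt p / Real.pi : ℂ) * DirichletCharacter.LFunction (chiC p) 1 := by
  have : NeZero p := ⟨(Fact.out : p.Prime).ne_zero⟩
  have h := ZMod.LFunction_one_sub (fun x => chiC p x) (s := 1) ?_ (Or.inl (by simp [chiC_apply]))
  · rw [sub_self, chi_neg_fun p hp4, map_neg] at h
    have h1 : ZMod.dft (fun x => chiC p x) = fun x => -(Complex.I * (Real.sqrt p : ℂ)) * chiC p x :=
      funext (dft_chi p hp4)
    have h2 : ∀ (c : ℂ) (f : ZMod p → ℂ), ZMod.LFunction (fun x => c * f x) 1 =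
        c * ZMod.LFunction f 1 := by
      intro c f
      simp only [ZMod.LFunction, Finset.mul_sum]
      refine Finset.sum_congr rfl fun j _ => ?_
      ring
    have h3 : -(ZMod.dft fun x => chiC p x) = fun x => (Complex.I * (Real.sqrt p : ℂ)) * chiC p x := by
      rw [h1]; funext x; simp
    rw [h3, h1, h2, h2, Complex.cpow_zero, Complex.Gamma_one, Complex.cpow_neg_one,
      mul_one, mul_one, mul_one] at h
    have e1 : Complex.exp (Real.pi * Complex.I / 2) = Complex.I := by
      have : (Real.pi * Complex.I / 2 : ℂ) = Real.pi / 2 * Complex.I := by ring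
      rw [this, Complex.exp_pi_div_two_mul_I]
    have e2 : Complex.exp (-Real.pi * Complex.I / 2) = -Complex.I := by
      rw [neg_mul, neg_div, Complex.exp_neg, e1, Complex.inv_I]
    rw [e1, e2] at h
    have h4 : DirichletCharacter.LFunction (chiC p) 0 = ZMod.LFunction (fun x => chiC p x) 0 := rfl
    have h5 : DirichletCharacter.LFunction (chiC p) 1 = ZMod.LFunction (fun x => chiC p x) 1 := rfl
    have h6 : ZMod.LFunction (⇑(chiC p)) 1 = ZMod.LFunction (fun x => chiC p x) 1 := rfl
    rw [h4, h5, h, h6]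
    clear h h1 h2 h3 h4 h5 h6
    have hpi : (Real.pi : ℂ) ≠ 0 := by exact_mod_cast Real.pi_ne_zero
    field_simp
    linear_combination (-2 * (Real.sqrt p : ℂ) * ZMod.LFunction (fun x => chiC p x) 1) * Complex.I_sq
  · intro n h
    have h1 := congrArg Complex.re h
    simp at h1
    have h3 : (0 : ℝ) ≤ n := n.cast_nonneg
    linarith

variable {p} in
lemma class_number_formula {K : Type*} [Field K] [NumberField K] (hp3 : 3 < p) (hp4 : p % 4 = 3) {θ : K}
    (hθ : θ ^ 2 = -(p : K)) (hgen : ∀ y : K, y ∈ Algebra.adjoin ℚ ({θ} : Set K)) :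
    (classNumber K : ℤ) * p =
      -∑ j ∈ Finset.range p, quadraticChar (ZMod p) (j : ZMod p) * (j : ℤ) := by
  have h1 := LFun_eq p hp4
  rw [LZero_eq p hp4, LOne hp3 hp4 hθ hgen] at h1
  have hp0 : (0 : ℝ) < p := by exact_mod_cast (Fact.out : p.Prime).pos
  have hs : Real.sqrt p ≠ 0 := (Real.sqrt_pos.2 hp0).ne'
  have h2 : F0 p = Real.sqrt p / Real.pi * (Real.pi * classNumber K / Real.sqrt p) := by
    exact_mod_cast h1
  have h3 : F0 p = classNumber K := by
    rw [h2]; field_simp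
  rw [F0, div_eq_iff hp0.ne'] at h3
  have h4 : ((classNumber K : ℤ) * p : ℝ) =
      ((-∑ j ∈ Finset.range p, quadraticChar (ZMod p) (j : ZMod p) * (j : ℤ) : ℤ) : ℝ) := by
    push_cast
    rw [← h3]
    rfl
  exact_mod_cast h4

end ClassNo


section Assembly

lemma mod_four_aux (f : ℕ → ℤ) (m : ℕ) (hf : ∀ j ∈ Finset.Icc 1 m, f j = 1 ∨ f j = -1) :
    ((∏ j ∈ Finset.Icc 1 m, f j) = 1 ∨ (∏ j ∈ Finset.Icc 1 m, f j) = -1) ∧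
    (4 : ℤ) ∣ (∑ j ∈ Finset.Icc 1 m, f j) - (m - 1 + ∏ j ∈ Finset.Icc 1 m, f j) ∧
    (4 : ℤ) ∣ 2 * (∑ j ∈ Finset.Icc 1 m, f j * j) - m * (m + 1) := by
  induction m with
  | zero => simp
  | succ m ih =>
    obtain ⟨h1, ⟨u, h2⟩, ⟨v, h3⟩⟩ := ih fun j hj => hf j (by simp at hj ⊢; omega)
    have he := hf (m + 1) (by simp)
    rw [Finset.prod_Icc_succ_top (by omega), Finset.sum_Icc_succ_top (by omega),
      Finset.sum_Icc_succ_top (by omega)]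
    set P := ∏ j ∈ Finset.Icc 1 m, f j
    set S := ∑ j ∈ Finset.Icc 1 m, f j
    set T := ∑ j ∈ Finset.Icc 1 m, f j * j
    push_cast
    rcases he with he | he
    · rw [he]
      refine ⟨by rw [mul_one]; exact h1, ⟨u, by linear_combination h2⟩, ⟨v, by linear_combination h3⟩⟩
    · rw [he]
      refine ⟨by rcases h1 with h | h <;> rw [h] <;> norm_num, ?_,
        ⟨v - (m + 1), by linear_combination h3⟩⟩
      rcases h1 with h | h <;> rw [h] at h2 ⊢
      · exact ⟨u, by linear_combination h2⟩
      · exact ⟨u - 1, by linear_combination h2⟩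

lemma half_sum (p : ℕ) [Fact p.Prime] (hp4 : p % 4 = 3) :
    ∑ j ∈ Finset.range p, quadraticChar (ZMod p) (j : ZMod p) * (j : ℤ) =
    2 * (∑ j ∈ Finset.Icc 1 (p / 2), quadraticChar (ZMod p) (j : ZMod p) * (j : ℤ)) -
      p * ∑ j ∈ Finset.Icc 1 (p / 2), quadraticChar (ZMod p) (j : ZMod p) := by
  have h1 : Finset.range p = insert 0 (Finset.Icc 1 (p / 2) ∪
      (Finset.Icc 1 (p / 2)).image (fun j => p - j)) := by
    ext x
    simp only [Finset.mem_range, Finset.mem_insert, Finset.mem_union, Finset.mem_Icc,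
      Finset.mem_image]
    constructor
    · intro hx
      by_cases h0 : x = 0
      · left; exact h0
      · right
        by_cases h : x ≤ p / 2
        · left; omega
        · right; exact ⟨p - x, by omega, by omega⟩
    · rintro (h | h | ⟨a, h, rfl⟩) <;> omega
  rw [h1, Finset.sum_insert, Finset.sum_union, Finset.sum_image]
  · have h2 : ∀ j ∈ Finset.Icc 1 (p / 2),
        quadraticChar (ZMod p) ((p - j : ℕ) : ZMod p) * ((p - j : ℕ) : ℤ) =
        quadraticChar (ZMod p) (j : ZMod p) * (j : ℤ) - p * quadraticChar (ZMod p) (j : ZMod p) := by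
      intro j hj
      rw [Finset.mem_Icc] at hj
      rw [Nat.cast_sub (by omega), Nat.cast_sub (by omega), ZMod.natCast_self, zero_sub,
        quadChar_neg p hp4]
      ring
    rw [Finset.sum_congr rfl h2, Finset.sum_sub_distrib, ← Finset.mul_sum]
    push_cast
    ring
  · intro a ha b hb h
    simp at ha hb h
    omega
  · rw [Finset.disjoint_left]
    intro x hx hy
    simp at hx hy
    omega
  · simp
    omega

lemma sign_formula {p : ℕ} [Fact p.Prime] {K : Type*} [Field K] [NumberField K] (hp3 : 3 < p)
    (hp4 : p % 4 = 3) {θ : K}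
    (hθ : θ ^ 2 = -(p : K)) (hgen : ∀ y : K, y ∈ Algebra.adjoin ℚ ({θ} : Set K)) :
    (-1 : ℤ) ^ ((NumberField.classNumber K - 1) / 2) =
      -∏ k ∈ Finset.Icc 1 (p / 2), quadraticChar (ZMod p) (k : ZMod p) ∧
    (∏ k ∈ Finset.Icc 1 (p / 2), quadraticChar (ZMod p) (k : ZMod p) = 1 ∨
      ∏ k ∈ Finset.Icc 1 (p / 2), quadraticChar (ZMod p) (k : ZMod p) = -1) := by
  have h := class_number_formula hp3 hp4 hθ hgen
  rw [half_sum p hp4] at h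
  obtain ⟨h1, ⟨u, h2⟩, ⟨v, h3⟩⟩ := mod_four_aux (fun j => quadraticChar (ZMod p) (j : ZMod p)) (p / 2)
    (by
      intro j hj
      rw [Finset.mem_Icc] at hj
      apply quadraticChar_dichotomy
      rw [Ne, ZMod.natCast_eq_zero_iff]
      intro hd
      have := Nat.le_of_dvd (by omega) hd
      omega)
  refine ⟨?_, h1⟩
  set P := ∏ k ∈ Finset.Icc 1 (p / 2), quadraticChar (ZMod p) (k : ZMod p)
  set S := ∑ k ∈ Finset.Icc 1 (p / 2), quadraticChar (ZMod p) (k : ZMod p)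
  set T := ∑ k ∈ Finset.Icc 1 (p / 2), quadraticChar (ZMod p) (k : ZMod p) * (k : ℤ)
  set H := NumberField.classNumber K
  obtain ⟨k, hk⟩ : ∃ k, p = 4 * k + 3 := ⟨p / 4, by omega⟩
  have hn : p / 2 = 2 * k + 1 := by omega
  rw [hn] at h2 h3
  have hH : ∃ w : ℤ, (H : ℤ) = -P + 4 * w := by
    refine ⟨u + v + k ^ 2 + 2 * k + (k + 1) * (H - S) + (P + 1) / 2, ?_⟩
    have hP2 : 2 * ((P + 1) / 2) = P + 1 := by rcases h1 with h | h <;> rw [h] <;> norm_num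
    have hk' : (p : ℤ) = 4 * k + 3 := by exact_mod_cast hk
    rw [hk'] at h
    push_cast at h2 h3
    linear_combination -h + h2 + h3 - 2 * hP2
  obtain ⟨w, hw⟩ := hH
  rcases h1 with h1 | h1
  · rw [h1] at hw ⊢
    have : (H - 1) / 2 = 2 * ((H - 3) / 4) + 1 := by omega
    rw [this, pow_succ, pow_mul]
    norm_num
  · rw [h1] at hw ⊢
    have : (H - 1) / 2 = 2 * ((H - 1) / 4) := by omega
    rw [this, pow_mul]
    norm_num

end Assembly

theorem stmt15 (p : ℕ) [Fact p.Prime] (hp : 3 < p) (hp4 : p % 4 = 3) (a b : ℤ)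
    (hab : legendreSym p (-(a * b)) = -1)
    (K : Type) [Field K] [NumberField K] (θ : K) (hθ : θ ^ 2 = -(p : K))
    (hgen : ∀ y : K, y ∈ Algebra.adjoin ℚ ({θ} : Set K)) (x : ℝ) :
    Matrix.det (Matrix.of fun j k : Fin ((p + 1) / 2) =>
      if (j : ℕ) = 0 then (1 : ℝ)
      else x + Real.cot (Real.pi *
        ((a * ((j : ℕ) : ℤ) ^ 2 + b * ((k : ℕ) : ℤ) ^ 2 : ℤ) : ℝ) / p)) =
    (-1 : ℝ) ^ ((NumberField.classNumber K - 1) / 2) * (legendreSym p a : ℝ) *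
      2 ^ ((p - 1) / 2) / Real.sqrt p := by
  have e1 : (p + 1) / 2 = p / 2 + 1 := by omega
  have e2 : (p - 1) / 2 = p / 2 := by omega
  rw [e1, e2]
  rw [Matrix.det_eq_of_forall_row_eq_smul_add_const
    (B := Matrix.of fun j k : Fin (p / 2 + 1) => if (j : ℕ) = 0 then (1 : ℝ)
      else Real.cot (Real.pi *
        ((a * ((j : ℕ) : ℤ) ^ 2 + b * ((k : ℕ) : ℤ) ^ 2 : ℤ) : ℝ) / p))
    (fun j => if (j : ℕ) = 0 then 0 else x) 0 (by simp)
    (by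
      intro i j
      by_cases hi : (i : ℕ) = 0
      · simp only [Matrix.of_apply, if_pos hi]; simp
      · simp only [Matrix.of_apply, if_neg hi]; simp; ring)]
  apply Complex.ofReal_injective
  have hD : ((Matrix.det (Matrix.of fun j k : Fin (p / 2 + 1) => if (j : ℕ) = 0 then (1 : ℝ)
      else Real.cot (Real.pi *
        ((a * ((j : ℕ) : ℤ) ^ 2 + b * ((k : ℕ) : ℤ) ^ 2 : ℤ) : ℝ) / p)) : ℝ) : ℂ) =
      DC p (a : ZMod p) (b : ZMod p) := by
    have h := RingHom.map_det Complex.ofRealHom (Matrix.of fun j k : Fin (p / 2 + 1) =>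
      if (j : ℕ) = 0 then (1 : ℝ) else Real.cot (Real.pi *
        ((a * ((j : ℕ) : ℤ) ^ 2 + b * ((k : ℕ) : ℤ) ^ 2 : ℤ) : ℝ) / p))
    rw [Complex.ofRealHom_eq_coe] at h
    rw [h, DC]
    congr 1
    ext i j
    simp only [RingHom.mapMatrix_apply, Matrix.map_apply, Matrix.of_apply,
      Complex.ofRealHom_eq_coe]
    by_cases hi : (i : ℕ) = 0
    · rw [if_pos hi, if_pos hi, Complex.ofReal_one]
    · rw [if_neg hi, if_neg hi, ctc_eq]
      push_cast
      rfl
  rw [hD, DC_general hp4 (by simpa [legendreSym] using hab)]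
  have h11 := DC11 (p := p) hp hp4
  obtain ⟨hs, hP⟩ := sign_formula hp hp4 hθ hgen
  have hs' : (-1 : ℂ) ^ ((NumberField.classNumber K - 1) / 2) =
      -((∏ k ∈ Finset.Icc 1 (p / 2), quadraticChar (ZMod p) (k : ZMod p) : ℤ) : ℂ) := by
    exact_mod_cast congrArg (Int.cast : ℤ → ℂ) hs
  have hP2 : ((∏ k ∈ Finset.Icc 1 (p / 2), quadraticChar (ZMod p) (k : ZMod p) : ℤ) : ℂ) ^ 2 = 1 := by
    rcases hP with h | h <;> rw [h] <;> norm_num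
  have hp0 : (0 : ℝ) < p := by exact_mod_cast (Fact.out : p.Prime).pos
  have hsq : (Real.sqrt p : ℂ) ≠ 0 := by exact_mod_cast (Real.sqrt_pos.2 hp0).ne'
  generalize (∏ k ∈ Finset.Icc 1 (p / 2), quadraticChar (ZMod p) (k : ZMod p) : ℤ) = P at *
  have hle : ((legendreSym p a : ℤ) : ℂ) = ((quadraticChar (ZMod p) (a : ZMod p) : ℤ) : ℂ) := rfl
  push_cast
  rw [hs', hle, eq_div_iff hsq]
  linear_combination (P * ((quadraticChar (ZMod p) (a : ZMod p) : ℤ) : ℂ)) * h11 -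
    (DC p 1 1 * (Real.sqrt p : ℂ) * ((quadraticChar (ZMod p) (a : ZMod p) : ℤ) : ℂ)) * hP2
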